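/- arXiv:2311.09686 — 2 statements merged into one kernel-verified Lean document; each statement's English description precedes it below -/
import Mathlib

section
/- Let A be a symmetric, uniformly elliptic matrix-valued function with Lipschitz entries on B_R = B(0,R) ⊆ ℝ^k, and let v ∈ W^{1,2}_loc(B_R) be a weak solution of div(A∇v) = 0 in B_R. Then for every choice of radii 0 < r₁ < r₂ < r₃ < R there exist C > 0 and β ∈ (0,1), depending only on R, r₁, r₂, r₃, the Lipschitz constant of the entries of A and the ellipticity constant of A, such that ‖v‖_{L²(B_{r₂})} ≤ C · ‖v‖_{L²(B_{r₁})}^β · ‖v‖_{L²(B_{r₃})}^{1−β}. -/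
open MeasureTheory Metric Set
open scoped ENNReal NNReal Topology ContDiff

noncomputable section
attribute [local instance] Classical.propDecidable

abbrev Euc (n : ℕ) := EuclideanSpace ℝ (Fin n)

/-- The gradient vector of `v` at `x`, as a tuple of partial derivatives. -/
def gradVec {k : ℕ} (v : Euc k → ℝ) (x : Euc k) : Fin k → ℝ :=
  fun i => fderiv ℝ v x (EuclideanSpace.single i 1)

/-- The bilinear form `⟨A ξ, ζ⟩ = ∑ i j, A i j * ξ j * ζ i` associated with a matrix. -/
def aForm {k : ℕ} (A : Matrix (Fin k) (Fin k) ℝ) (ξ ζ : Fin k → ℝ) : ℝ :=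
  ∑ i, ∑ j, A i j * ξ j * ζ i

/-- `A` is uniformly elliptic with constant `Λ` on `U`:
`Λ⁻¹|ξ|² ≤ ⟨A(x)ξ, ξ⟩ ≤ Λ|ξ|²` for all `x ∈ U`, `ξ ∈ ℝᵏ`. -/
def UnifElliptic {k : ℕ} (A : Euc k → Matrix (Fin k) (Fin k) ℝ) (Λ : ℝ) (U : Set (Euc k)) :
    Prop :=
  ∀ x ∈ U, ∀ ξ : Fin k → ℝ,
    Λ⁻¹ * (∑ i, ξ i ^ 2) ≤ aForm (A x) ξ ξ ∧ aForm (A x) ξ ξ ≤ Λ * (∑ i, ξ i ^ 2)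

/-- The entries of `A` are Lipschitz with constant `L` on `U`. -/
def LipEntries {k : ℕ} (A : Euc k → Matrix (Fin k) (Fin k) ℝ) (L : ℝ≥0) (U : Set (Euc k)) :
    Prop :=
  ∀ i j, LipschitzOnWith L (fun x => A x i j) U

/-- `v` is a weak solution of `div(A ∇v) = 0` in `U`:
`∫_U ⟨A(x)∇v(x), ∇ψ(x)⟩ dx = 0` for every test function `ψ ∈ C_c^∞(U)`. -/
def IsWeakSol {k : ℕ} (A : Euc k → Matrix (Fin k) (Fin k) ℝ) (v : Euc k → ℝ)
    (U : Set (Euc k)) : Prop :=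
  ∀ ψ : Euc k → ℝ, ContDiff ℝ ∞ ψ → HasCompactSupport ψ → tsupport ψ ⊆ U →
    ∫ x in U, aForm (A x) (gradVec v x) (gradVec ψ x) = 0

/-- `α(x) = ⟨A(x)x, x⟩/|x|²`, with `α(0) = 1`. -/
def alphaFn {k : ℕ} (A : Euc k → Matrix (Fin k) (Fin k) ℝ) (x : Euc k) : ℝ :=
  if x = 0 then 1 else aForm (A x) (fun i => x i) (fun i => x i) / ‖x‖ ^ 2

/-- `H_v(x,r) = ∫_{B(x,r)} α v²`. -/
def Hfun {k : ℕ} (A : Euc k → Matrix (Fin k) (Fin k) ℝ) (v : Euc k → ℝ) (x : Euc k)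
    (r : ℝ) : ℝ :=
  ∫ z in ball x r, alphaFn A z * v z ^ 2

/-- The frequency function `N_v(x,r) = r ∂_r H_v(x,r) / H_v(x,r)`. -/
def freqN {k : ℕ} (A : Euc k → Matrix (Fin k) (Fin k) ℝ) (v : Euc k → ℝ) (x : Euc k)
    (r : ℝ) : ℝ :=
  r * deriv (Hfun A v x) r / Hfun A v x r

/-- The doubling index `𝒩_v(x,r) = log (H_v(x,2r) / H_v(x,r))`. -/
def doubN {k : ℕ} (A : Euc k → Matrix (Fin k) (Fin k) ℝ) (v : Euc k → ℝ) (x : Euc k)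
    (r : ℝ) : ℝ :=
  Real.log (Hfun A v x (2 * r) / Hfun A v x r)

/-- The `L²` norm of `v` on the set `s` (with respect to Lebesgue measure). -/
def l2norm {k : ℕ} (v : Euc k → ℝ) (s : Set (Euc k)) : ℝ :=
  Real.sqrt (∫ x in s, v x ^ 2)


/-- partial derivative -/
def pd {k : ℕ} (i : Fin k) (F : Euc k → ℝ) (x : Euc k) : ℝ :=
  fderiv ℝ F x (EuclideanSpace.single i 1)

section pdcalc
variable {k : ℕ}

theorem pd_contDiff {F : Euc k → ℝ} (hF : ContDiff ℝ ∞ F) (i : Fin k) :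
    ContDiff ℝ ∞ (pd i F) := by
  unfold pd
  exact (hF.fderiv_right (m := ∞) (by norm_cast)).clm_apply contDiff_const

theorem pd_mul {F G : Euc k → ℝ} {x : Euc k} (hF : DifferentiableAt ℝ F x)
    (hG : DifferentiableAt ℝ G x) (i : Fin k) :
    pd i (fun y => F y * G y) x = pd i F x * G x + F x * pd i G x := by
  unfold pd
  rw [fderiv_fun_mul hF hG]
  simp; ring

theorem pd_add {F G : Euc k → ℝ} {x : Euc k} (hF : DifferentiableAt ℝ F x)
    (hG : DifferentiableAt ℝ G x) (i : Fin k) :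
    pd i (fun y => F y + G y) x = pd i F x + pd i G x := by
  unfold pd
  rw [fderiv_fun_add hF hG]
  simp

theorem pd_const_mul {F : Euc k → ℝ} {x : Euc k} (c : ℝ) (hF : DifferentiableAt ℝ F x)
    (i : Fin k) :
    pd i (fun y => c * F y) x = c * pd i F x := by
  unfold pd
  rw [fderiv_const_mul hF]
  simp

theorem pd_sum {ι : Type*} (s : Finset ι) {F : ι → Euc k → ℝ} {x : Euc k}
    (hF : ∀ j ∈ s, DifferentiableAt ℝ (F j) x) (i : Fin k) :
    pd i (fun y => ∑ j ∈ s, F j y) x = ∑ j ∈ s, pd i (F j) x := by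
  unfold pd
  rw [fderiv_fun_sum hF]
  simp

theorem pd_coord (i j : Fin k) (x : Euc k) :
    pd i (fun y : Euc k => y j) x = if j = i then 1 else 0 := by
  unfold pd
  have : HasFDerivAt (fun y : Euc k => y j) (EuclideanSpace.proj (𝕜 := ℝ) j) x :=
    (EuclideanSpace.proj (𝕜 := ℝ) j : Euc k →L[ℝ] ℝ).hasFDerivAt
  rw [this.fderiv]
  simp

theorem pd_exp {F : Euc k → ℝ} {x : Euc k} (hF : DifferentiableAt ℝ F x) (i : Fin k) :
    pd i (fun y => Real.exp (F y)) x = Real.exp (F x) * pd i F x := by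
  unfold pd
  rw [fderiv_exp hF]
  simp

theorem pd_comm {F : Euc k → ℝ} (hF : ContDiff ℝ ∞ F) (i j : Fin k) (x : Euc k) :
    pd i (pd j F) x = pd j (pd i F) x := by
  have hd : DifferentiableAt ℝ (fderiv ℝ F) x :=
    ((hF.fderiv_right (m := ∞) (by norm_cast)).differentiable (by norm_num)) x
  have h := (hF.contDiffAt (x := x)).isSymmSndFDerivAt (by simp; exact WithTop.coe_le_coe.2 (le_top : (2:ℕ∞) ≤ ⊤))
  have key : ∀ i j : Fin k, pd i (pd j F) x =
      fderiv ℝ (fderiv ℝ F) x (EuclideanSpace.single i 1) (EuclideanSpace.single j 1) := by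
    intro i j
    unfold pd
    rw [fderiv_clm_apply hd (by fun_prop)]
    simp
  rw [key, key]
  exact h.eq _ _

theorem pd_congr {F G : Euc k → ℝ} {x : Euc k} (h : F =ᶠ[𝓝 x] G) (i : Fin k) :
    pd i F x = pd i G x := by
  unfold pd; rw [h.fderiv_eq]

theorem pd_const (c : ℝ) (i : Fin k) (x : Euc k) : pd i (fun _ => c) x = 0 := by
  simp [pd]

theorem pd_hasCompactSupport {F : Euc k → ℝ} (hF : HasCompactSupport F) (i : Fin k) :
    HasCompactSupport (pd i F) := hF.fderiv_apply (𝕜 := ℝ) _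

theorem integral_pd {F : Euc k → ℝ} (hF : ContDiff ℝ ∞ F) (hc : HasCompactSupport F)
    (i : Fin k) : ∫ x, pd i F x = 0 := by
  have hF' : Integrable F := hF.continuous.integrable_of_hasCompactSupport hc
  have hp : Integrable (pd i F) :=
    (pd_contDiff hF i).continuous.integrable_of_hasCompactSupport (pd_hasCompactSupport hc i)
  have := integral_mul_fderiv_eq_neg_fderiv_mul_of_integrable (μ := volume) (𝕜 := ℝ)
    (f := fun _ : Euc k => (1:ℝ)) (g := F) (v := EuclideanSpace.single i 1)
    (by simp) (by simp only [one_mul]; exact hp) (by simpa using hF')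
    (by intros; fun_prop) (fun x _ => (hF.differentiable (by norm_num)) x)
  simpa [pd] using this

theorem ContDiff.dat {F : Euc k → ℝ} (hF : ContDiff ℝ ∞ F) (x : Euc k) :
    DifferentiableAt ℝ F x := (hF.differentiable (by norm_num)) x

end pdcalc

section ident
variable {k : ℕ}

def flux (a : Fin k → Fin k → Euc k → ℝ) (w : Euc k → ℝ) (i : Fin k) (x : Euc k) : ℝ :=
  ∑ j, a i j x * pd j w x

def Lop (a : Fin k → Fin k → Euc k → ℝ) (w : Euc k → ℝ) (x : Euc k) : ℝ :=
  ∑ i, pd i (flux a w i) x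

def en (a : Fin k → Fin k → Euc k → ℝ) (w : Euc k → ℝ) (x : Euc k) : ℝ :=
  ∑ i, flux a w i x * pd i w x

def dirD (X : Fin k → Euc k → ℝ) (w : Euc k → ℝ) (x : Euc k) : ℝ :=
  ∑ m, X m x * pd m w x

theorem flux_contDiff {a : Fin k → Fin k → Euc k → ℝ} (ha : ∀ i j, ContDiff ℝ ∞ (a i j))
    {w : Euc k → ℝ} (hw : ContDiff ℝ ∞ w) (i : Fin k) : ContDiff ℝ ∞ (flux a w i) := by
  unfold flux
  exact ContDiff.sum fun j _ => (ha i j).mul (pd_contDiff hw j)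

theorem Lop_contDiff {a : Fin k → Fin k → Euc k → ℝ} (ha : ∀ i j, ContDiff ℝ ∞ (a i j))
    {w : Euc k → ℝ} (hw : ContDiff ℝ ∞ w) : ContDiff ℝ ∞ (Lop a w) := by
  unfold Lop
  exact ContDiff.sum fun j _ => pd_contDiff (flux_contDiff ha hw j) j

theorem en_contDiff {a : Fin k → Fin k → Euc k → ℝ} (ha : ∀ i j, ContDiff ℝ ∞ (a i j))
    {w : Euc k → ℝ} (hw : ContDiff ℝ ∞ w) : ContDiff ℝ ∞ (en a w) := by
  unfold en
  exact ContDiff.sum fun j _ => (flux_contDiff ha hw j).mul (pd_contDiff hw j)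

theorem dirD_contDiff {X : Fin k → Euc k → ℝ} (hX : ∀ i, ContDiff ℝ ∞ (X i))
    {w : Euc k → ℝ} (hw : ContDiff ℝ ∞ w) : ContDiff ℝ ∞ (dirD X w) := by
  unfold dirD
  exact ContDiff.sum fun j _ => (hX j).mul (pd_contDiff hw j)

theorem pd_flux {a : Fin k → Fin k → Euc k → ℝ} (ha : ∀ i j, ContDiff ℝ ∞ (a i j))
    {w : Euc k → ℝ} (hw : ContDiff ℝ ∞ w) (i m : Fin k) (x : Euc k) :
    pd m (flux a w i) x = ∑ j, (pd m (a i j) x * pd j w x + a i j x * pd m (pd j w) x) := by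
  unfold flux
  rw [pd_sum _ (F := fun j y => a i j y * pd j w y)
    (fun j _ => ((ha i j).dat x).mul ((pd_contDiff hw j).dat x))]
  exact Finset.sum_congr rfl fun j _ => pd_mul ((ha i j).dat x) ((pd_contDiff hw j).dat x) m

theorem pd_en {a : Fin k → Fin k → Euc k → ℝ} (ha : ∀ i j, ContDiff ℝ ∞ (a i j))
    {w : Euc k → ℝ} (hw : ContDiff ℝ ∞ w) (m : Fin k) (x : Euc k) :
    pd m (en a w) x = ∑ i, (pd m (flux a w i) x * pd i w x + flux a w i x * pd m (pd i w) x) := by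
  unfold en
  rw [pd_sum _ (F := fun j y => flux a w j y * pd j w y)
    (fun j _ => ((flux_contDiff ha hw j).dat x).mul ((pd_contDiff hw j).dat x))]
  exact Finset.sum_congr rfl fun j _ =>
    pd_mul ((flux_contDiff ha hw j).dat x) ((pd_contDiff hw j).dat x) m

theorem pd_dirD {X : Fin k → Euc k → ℝ} (hX : ∀ i, ContDiff ℝ ∞ (X i))
    {w : Euc k → ℝ} (hw : ContDiff ℝ ∞ w) (i : Fin k) (x : Euc k) :
    pd i (dirD X w) x = ∑ m, (pd i (X m) x * pd m w x + X m x * pd i (pd m w) x) := by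
  unfold dirD
  rw [pd_sum _ (F := fun j y => X j y * pd j w y)
    (fun j _ => ((hX j).dat x).mul ((pd_contDiff hw j).dat x))]
  exact Finset.sum_congr rfl fun j _ =>
    pd_mul ((hX j).dat x) ((pd_contDiff hw j).dat x) i

/-- the term `∑ F_i ∂_i X_m w_m` -/
def tDX (a : Fin k → Fin k → Euc k → ℝ) (X : Fin k → Euc k → ℝ) (w : Euc k → ℝ) (x : Euc k) : ℝ :=
  ∑ i, ∑ m, flux a w i x * pd i (X m) x * pd m w x

/-- the term `∑ X_m ∂_m a_ij w_j w_i` -/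
def tDA (a : Fin k → Fin k → Euc k → ℝ) (X : Fin k → Euc k → ℝ) (w : Euc k → ℝ) (x : Euc k) : ℝ :=
  ∑ m, ∑ i, ∑ j, X m x * pd m (a i j) x * pd j w x * pd i w x

theorem rellich_pt {a : Fin k → Fin k → Euc k → ℝ} (ha : ∀ i j, ContDiff ℝ ∞ (a i j))
    (hs : ∀ i j, a i j = a j i)
    {X : Fin k → Euc k → ℝ} (hX : ∀ i, ContDiff ℝ ∞ (X i))
    {w : Euc k → ℝ} (hw : ContDiff ℝ ∞ w) (x : Euc k) :
    2 * ∑ i, flux a w i x * pd i (dirD X w) x - ∑ m, X m x * pd m (en a w) x =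
      2 * tDX a X w x - tDA a X w x := by
  have e1 : ∑ i, flux a w i x * pd i (dirD X w) x =
      tDX a X w x + ∑ m, X m x * ∑ i, flux a w i x * pd m (pd i w) x := by
    simp only [pd_dirD hX hw, tDX, mul_add, Finset.sum_add_distrib, Finset.mul_sum]
    congr 1
    · exact Finset.sum_congr rfl fun i _ => Finset.sum_congr rfl fun m _ => by ring
    · rw [Finset.sum_comm]
      refine Finset.sum_congr rfl fun i _ => Finset.sum_congr rfl fun m _ => ?_
      rw [pd_comm hw m i]; ring
  have e3 : ∀ m, ∑ i, (∑ j, a i j x * pd m (pd j w) x) * pd i w x =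
      ∑ i, flux a w i x * pd m (pd i w) x := by
    intro m
    simp only [flux, Finset.sum_mul]
    rw [Finset.sum_comm]
    refine Finset.sum_congr rfl fun i _ => Finset.sum_congr rfl fun j _ => ?_
    rw [hs i j]; ring
  have e2 : ∑ m, X m x * pd m (en a w) x =
      tDA a X w x + 2 * ∑ m, X m x * ∑ i, flux a w i x * pd m (pd i w) x := by
    have : ∀ m, pd m (en a w) x = (∑ i, ∑ j, pd m (a i j) x * pd j w x * pd i w x) +
        2 * ∑ i, flux a w i x * pd m (pd i w) x := by
      intro m
      rw [pd_en ha hw, Finset.sum_add_distrib, two_mul, ← add_assoc]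
      congr 1
      rw [← e3 m, ← Finset.sum_add_distrib]
      refine Finset.sum_congr rfl fun i _ => ?_
      rw [pd_flux ha hw, Finset.sum_add_distrib, add_mul, Finset.sum_mul]
    simp only [this, mul_add, Finset.sum_add_distrib, tDA, Finset.mul_sum]
    congr 1
    · refine Finset.sum_congr rfl fun i _ => Finset.sum_congr rfl fun j _ =>
        Finset.sum_congr rfl fun l _ => by ring
    · refine Finset.sum_congr rfl fun i _ => Finset.sum_congr rfl fun j _ => by ring
  rw [e1, e2]; ring

def Qform (a : Fin k → Fin k → Euc k → ℝ) (X : Fin k → Euc k → ℝ) (g q : Euc k → ℝ) (τ : ℝ)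
    (w : Euc k → ℝ) (x : Euc k) : ℝ :=
  2 * τ * (2 * tDX a X w x - (∑ i, pd i (X i) x) * en a w x - tDA a X w x + g x * en a w x
    + w x * (∑ i, flux a w i x * pd i g x)
    + τ ^ 2 * ((∑ i, (pd i q x * X i x + q x * pd i (X i) x)) - q x * g x) * w x ^ 2)

def bigFlux (a : Fin k → Fin k → Euc k → ℝ) (X : Fin k → Euc k → ℝ) (g q : Euc k → ℝ) (τ : ℝ)
    (w : Euc k → ℝ) (i : Fin k) (x : Euc k) : ℝ :=
  (-4 * τ) * (flux a w i x * dirD X w x) + (2 * τ) * (X i x * en a w x)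
    + (-2 * τ) * ((g x * w x) * flux a w i x) + (-2 * τ ^ 3) * ((q x * X i x) * (w x * w x))

theorem ident_pt {a : Fin k → Fin k → Euc k → ℝ} (ha : ∀ i j, ContDiff ℝ ∞ (a i j))
    (hs : ∀ i j, a i j = a j i)
    {X : Fin k → Euc k → ℝ} (hX : ∀ i, ContDiff ℝ ∞ (X i))
    {g q : Euc k → ℝ} (hg : ContDiff ℝ ∞ g) (hq : ContDiff ℝ ∞ q) (τ : ℝ)
    {w : Euc k → ℝ} (hw : ContDiff ℝ ∞ w) (x : Euc k) :
    2 * (Lop a w x + τ ^ 2 * q x * w x) * (-2 * τ * dirD X w x - τ * g x * w x) =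
      Qform a X g q τ w x + ∑ i, pd i (bigFlux a X g q τ w i) x := by
  have hF := fun i => (flux_contDiff ha hw i).dat x
  have hZ := (dirD_contDiff hX hw).dat x
  have he := (en_contDiff ha hw).dat x
  have hX' := fun i => (hX i).dat x
  have hg' := hg.dat x
  have hq' := hq.dat x
  have hw' := hw.dat x
  have hp : ∀ i, pd i (bigFlux a X g q τ w i) x =
     (-4 * τ) * (pd i (flux a w i) x * dirD X w x + flux a w i x * pd i (dirD X w) x)
     + (2 * τ) * (pd i (X i) x * en a w x + X i x * pd i (en a w) x)
     + (-2 * τ) * ((pd i g x * w x + g x * pd i w x) * flux a w i x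
          + g x * w x * pd i (flux a w i) x)
     + (-2 * τ ^ 3) * ((pd i q x * X i x + q x * pd i (X i) x) * (w x * w x)
          + q x * X i x * (pd i w x * w x + w x * pd i w x)) := by
    intro i
    unfold bigFlux
    have := hF i
    have := hX' i
    rw [pd_add (by fun_prop) (by fun_prop), pd_add (by fun_prop) (by fun_prop),
      pd_add (by fun_prop) (by fun_prop), pd_const_mul _ (by fun_prop),
      pd_const_mul _ (by fun_prop), pd_const_mul _ (by fun_prop), pd_const_mul _ (by fun_prop),
      pd_mul (by fun_prop) (by fun_prop), pd_mul (by fun_prop) (by fun_prop),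
      pd_mul (by fun_prop) (by fun_prop), pd_mul (by fun_prop) (by fun_prop),
      pd_mul (by fun_prop) (by fun_prop), pd_mul (by fun_prop) (by fun_prop),
      pd_mul (by fun_prop) (by fun_prop)]
  have hsum : ∑ i, pd i (bigFlux a X g q τ w i) x =
     (-4 * τ) * (Lop a w x * dirD X w x + ∑ i, flux a w i x * pd i (dirD X w) x)
     + (2 * τ) * ((∑ i, pd i (X i) x) * en a w x + ∑ i, X i x * pd i (en a w) x)
     + (-2 * τ) * ((∑ i, flux a w i x * pd i g x) * w x + g x * (∑ i, flux a w i x * pd i w x)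
          + g x * w x * Lop a w x)
     + (-2 * τ ^ 3) * ((∑ i, (pd i q x * X i x + q x * pd i (X i) x)) * (w x * w x)
          + 2 * q x * w x * (∑ m, X m x * pd m w x)) := by
    simp only [Lop, hp, Finset.sum_mul, Finset.mul_sum, mul_add, add_mul,
      Finset.sum_add_distrib]
    simp only [← Finset.sum_add_distrib]
    refine Finset.sum_congr rfl fun i _ => ?_
    ring
  have hr := rellich_pt ha hs hX hw x
  have r1 : ∑ i, flux a w i x * pd i w x = en a w x := rfl
  have r2 : ∑ m, X m x * pd m w x = dirD X w x := rfl
  rw [hsum, r1, r2]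
  unfold Qform
  linear_combination (2 * τ) * hr

theorem hcs_of_eq {F w : Euc k → ℝ} (hc : HasCompactSupport w)
    (h : ∀ x, x ∉ tsupport w → F x = 0) : HasCompactSupport F :=
  HasCompactSupport.intro hc h

theorem pd_zero_of {w : Euc k → ℝ} {x : Euc k} (hx : x ∉ tsupport w) (i : Fin k) :
    pd i w x = 0 := by
  have := pd_congr (notMem_tsupport_iff_eventuallyEq.1 hx) i
  rw [this]; exact pd_const 0 i x

theorem flux_zero_of {a : Fin k → Fin k → Euc k → ℝ} {w : Euc k → ℝ} {x : Euc k}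
    (hx : x ∉ tsupport w) (i : Fin k) :
    flux a w i x = 0 := by
  simp [flux, pd_zero_of hx]

theorem Lop_zero_of {a : Fin k → Fin k → Euc k → ℝ} {w : Euc k → ℝ} {x : Euc k}
    (hx : x ∉ tsupport w) : Lop a w x = 0 := by
  unfold Lop
  refine Finset.sum_eq_zero fun i _ => ?_
  have : flux a w i =ᶠ[𝓝 x] fun _ => 0 := by
    filter_upwards [(isClosed_tsupport w).isOpen_compl.mem_nhds hx] with y hy
    exact flux_zero_of hy i
  rw [pd_congr this, pd_const]

theorem Qform_zero_of {a : Fin k → Fin k → Euc k → ℝ} {X : Fin k → Euc k → ℝ} {g q : Euc k → ℝ}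
    {τ : ℝ} {w : Euc k → ℝ} {x : Euc k}
    (hx : x ∉ tsupport w) : Qform a X g q τ w x = 0 := by
  simp [Qform, tDX, tDA, en, pd_zero_of hx, flux_zero_of hx, image_eq_zero_of_notMem_tsupport hx]

theorem ident_int {a : Fin k → Fin k → Euc k → ℝ} (ha : ∀ i j, ContDiff ℝ ∞ (a i j))
    (hs : ∀ i j, a i j = a j i)
    {X : Fin k → Euc k → ℝ} (hX : ∀ i, ContDiff ℝ ∞ (X i))
    {g q : Euc k → ℝ} (hg : ContDiff ℝ ∞ g) (hq : ContDiff ℝ ∞ q) (τ : ℝ)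
    {w : Euc k → ℝ} (hw : ContDiff ℝ ∞ w) (hc : HasCompactSupport w) :
    Integrable (fun x =>
      2 * (Lop a w x + τ ^ 2 * q x * w x) * (-2 * τ * dirD X w x - τ * g x * w x)) ∧
    Integrable (Qform a X g q τ w) ∧
    ∫ x, 2 * (Lop a w x + τ ^ 2 * q x * w x) * (-2 * τ * dirD X w x - τ * g x * w x) =
      ∫ x, Qform a X g q τ w x := by
  have hb : ∀ i, ContDiff ℝ ∞ (bigFlux a X g q τ w i) := by
    intro i
    have := flux_contDiff ha hw i
    have := dirD_contDiff hX hw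
    have := en_contDiff ha hw
    have := hX i
    unfold bigFlux
    fun_prop
  have hbc : ∀ i, HasCompactSupport (bigFlux a X g q τ w i) := by
    intro i
    refine hcs_of_eq hc fun x hx => ?_
    simp [bigFlux, en, flux_zero_of hx, image_eq_zero_of_notMem_tsupport hx]
  have hI1 : Integrable (fun x =>
      2 * (Lop a w x + τ ^ 2 * q x * w x) * (-2 * τ * dirD X w x - τ * g x * w x)) := by
    have := (Lop_contDiff ha hw).continuous
    have := (dirD_contDiff hX hw).continuous
    have := hq.continuous
    have := hg.continuous
    have := hw.continuous
    refine Continuous.integrable_of_hasCompactSupport (by fun_prop) (hcs_of_eq hc fun x hx => ?_)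
    simp [Lop_zero_of hx, image_eq_zero_of_notMem_tsupport hx]
  have hIp : ∀ i, Integrable (pd i (bigFlux a X g q τ w i)) := fun i =>
    (pd_contDiff (hb i) i).continuous.integrable_of_hasCompactSupport
      (pd_hasCompactSupport (hbc i) i)
  have hIs : Integrable (fun x => ∑ i, pd i (bigFlux a X g q τ w i) x) :=
    integrable_finsetSum _ fun i _ => hIp i
  have hQ : Qform a X g q τ w = fun x =>
      2 * (Lop a w x + τ ^ 2 * q x * w x) * (-2 * τ * dirD X w x - τ * g x * w x)
        - ∑ i, pd i (bigFlux a X g q τ w i) x := by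
    ext x; rw [ident_pt ha hs hX hg hq τ hw x]; ring
  refine ⟨hI1, by rw [hQ]; exact hI1.sub hIs, ?_⟩
  rw [hQ, integral_sub hI1 hIs, integral_finsetSum _ fun i _ => hIp i]
  simp [integral_pd (hb _) (hbc _)]

end ident

section weight
variable {k : ℕ}

structure Ell (Λ L : ℝ) (a : Fin k → Fin k → Euc k → ℝ) : Prop where
  smooth : ∀ i j, ContDiff ℝ ∞ (a i j)
  symm : ∀ i j, a i j = a j i
  lower : ∀ x, ∀ ξ : Fin k → ℝ, Λ⁻¹ * (∑ i, ξ i ^ 2) ≤ ∑ i, ∑ j, a i j x * ξ j * ξ i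
  bound : ∀ i j x, |a i j x| ≤ Λ
  dbound : ∀ m i j x, |pd m (a i j) x| ≤ L

def phi (lam : ℝ) (x : Euc k) : ℝ := Real.exp (-lam * ∑ i, x i * x i)

def yv (a : Fin k → Fin k → Euc k → ℝ) (m : Fin k) (x : Euc k) : ℝ := ∑ j, a m j x * x j

def bv (a : Fin k → Fin k → Euc k → ℝ) (x : Euc k) : ℝ := ∑ m, x m * yv a m x

def Xv (a : Fin k → Fin k → Euc k → ℝ) (lam : ℝ) (m : Fin k) (x : Euc k) : ℝ :=
  (-2 * lam) * (phi lam x * yv a m x)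

def qv (a : Fin k → Fin k → Euc k → ℝ) (lam : ℝ) (x : Euc k) : ℝ :=
  (4 * lam ^ 2) * ((phi lam x * phi lam x) * bv a x)

def gv (a : Fin k → Fin k → Euc k → ℝ) (lam : ℝ) (x : Euc k) : ℝ :=
  (8 * lam ^ 2) * (phi lam x * bv a x)

theorem coord_contDiff (j : Fin k) : ContDiff ℝ ∞ (fun y : Euc k => y j) :=
  (EuclideanSpace.proj (𝕜 := ℝ) j : Euc k →L[ℝ] ℝ).contDiff

theorem phi_contDiff (lam : ℝ) : ContDiff ℝ ∞ (phi (k := k) lam) := by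
  unfold phi
  exact Real.contDiff_exp.comp (contDiff_const.mul
    (ContDiff.sum fun i _ => (coord_contDiff i).mul (coord_contDiff i)))

theorem yv_contDiff {a : Fin k → Fin k → Euc k → ℝ} (ha : ∀ i j, ContDiff ℝ ∞ (a i j))
    (m : Fin k) : ContDiff ℝ ∞ (yv a m) := by
  unfold yv
  exact ContDiff.sum fun j _ => (ha m j).mul (coord_contDiff j)

theorem bv_contDiff {a : Fin k → Fin k → Euc k → ℝ} (ha : ∀ i j, ContDiff ℝ ∞ (a i j)) :
    ContDiff ℝ ∞ (bv a) := by
  unfold bv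
  exact ContDiff.sum fun j _ => (coord_contDiff j).mul (yv_contDiff ha j)

theorem Xv_contDiff {a : Fin k → Fin k → Euc k → ℝ} (ha : ∀ i j, ContDiff ℝ ∞ (a i j))
    (lam : ℝ) (m : Fin k) : ContDiff ℝ ∞ (Xv a lam m) := by
  have := yv_contDiff ha m
  have := phi_contDiff (k := k) lam
  unfold Xv
  fun_prop

theorem qv_contDiff {a : Fin k → Fin k → Euc k → ℝ} (ha : ∀ i j, ContDiff ℝ ∞ (a i j))
    (lam : ℝ) : ContDiff ℝ ∞ (qv a lam) := by
  have := bv_contDiff ha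
  have := phi_contDiff (k := k) lam
  unfold qv
  fun_prop

theorem gv_contDiff {a : Fin k → Fin k → Euc k → ℝ} (ha : ∀ i j, ContDiff ℝ ∞ (a i j))
    (lam : ℝ) : ContDiff ℝ ∞ (gv a lam) := by
  have := bv_contDiff ha
  have := phi_contDiff (k := k) lam
  unfold gv
  fun_prop

theorem pd_phi (lam : ℝ) (i : Fin k) (x : Euc k) :
    pd i (phi lam) x = -2 * lam * x i * phi lam x := by
  have h1 : ∀ j, DifferentiableAt ℝ (fun y : Euc k => y j) x := fun j => (coord_contDiff j).dat x
  have h2 : ∀ j, DifferentiableAt ℝ (fun y : Euc k => y j * y j) x := fun j => (h1 j).mul (h1 j)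
  have h3 : DifferentiableAt ℝ (fun y : Euc k => ∑ j, y j * y j) x :=
    DifferentiableAt.fun_sum fun j _ => h2 j
  unfold phi
  rw [pd_exp (h3.const_mul _), pd_const_mul _ h3, pd_sum _ (F := fun j (y : Euc k) => y j * y j)
    (fun j _ => h2 j)]
  have : ∀ j, pd i (fun y : Euc k => y j * y j) x = if j = i then 2 * x i else 0 := by
    intro j
    rw [pd_mul (h1 j) (h1 j), pd_coord]
    split_ifs with h
    · subst h; ring
    · ring
  simp only [this, Finset.sum_ite_eq', Finset.mem_univ, if_true]
  ring

theorem pd_yv {a : Fin k → Fin k → Euc k → ℝ} (ha : ∀ i j, ContDiff ℝ ∞ (a i j))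
    (i m : Fin k) (x : Euc k) :
    pd i (yv a m) x = (∑ j, pd i (a m j) x * x j) + a m i x := by
  have h1 : ∀ j, DifferentiableAt ℝ (fun y : Euc k => y j) x := fun j => (coord_contDiff j).dat x
  unfold yv
  rw [pd_sum _ (F := fun j (y : Euc k) => a m j y * y j) (fun j _ => ((ha m j).dat x).mul (h1 j))]
  have : ∀ j, pd i (fun y : Euc k => a m j y * y j) x =
      pd i (a m j) x * x j + if j = i then a m j x else 0 := by
    intro j
    rw [pd_mul ((ha m j).dat x) (h1 j), pd_coord]
    simp
  simp only [this, Finset.sum_add_distrib, Finset.sum_ite_eq', Finset.mem_univ, if_true]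

theorem pd_bv {a : Fin k → Fin k → Euc k → ℝ} (ha : ∀ i j, ContDiff ℝ ∞ (a i j))
    (i : Fin k) (x : Euc k) :
    pd i (bv a) x = yv a i x + ∑ m, x m * pd i (yv a m) x := by
  have h1 : ∀ j, DifferentiableAt ℝ (fun y : Euc k => y j) x := fun j => (coord_contDiff j).dat x
  have h2 := fun m => (yv_contDiff ha m).dat x
  unfold bv
  rw [pd_sum _ (F := fun j (y : Euc k) => y j * yv a j y) (fun j _ => (h1 j).mul (h2 j))]
  have : ∀ j, pd i (fun y : Euc k => y j * yv a j y) x =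
      (if j = i then yv a j x else 0) + x j * pd i (yv a j) x := by
    intro j
    rw [pd_mul (h1 j) (h2 j), pd_coord]
    simp
  simp only [this, Finset.sum_add_distrib, Finset.sum_ite_eq', Finset.mem_univ, if_true]

theorem pd_Xv {a : Fin k → Fin k → Euc k → ℝ} (ha : ∀ i j, ContDiff ℝ ∞ (a i j))
    (lam : ℝ) (i m : Fin k) (x : Euc k) :
    pd i (Xv a lam m) x = 4 * lam ^ 2 * phi lam x * (x i * yv a m x)
      - 2 * lam * phi lam x * pd i (yv a m) x := by
  have h2 := (yv_contDiff ha m).dat x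
  have h3 := (phi_contDiff (k := k) lam).dat x
  unfold Xv
  rw [pd_const_mul _ (by fun_prop), pd_mul (by fun_prop) (by fun_prop), pd_phi]
  ring

theorem pd_gv {a : Fin k → Fin k → Euc k → ℝ} (ha : ∀ i j, ContDiff ℝ ∞ (a i j))
    (lam : ℝ) (i : Fin k) (x : Euc k) :
    pd i (gv a lam) x = 8 * lam ^ 2 * phi lam x * (-2 * lam * bv a x * x i + pd i (bv a) x) := by
  have h2 := (bv_contDiff ha).dat x
  have h3 := (phi_contDiff (k := k) lam).dat x
  unfold gv
  rw [pd_const_mul _ (by fun_prop), pd_mul (by fun_prop) (by fun_prop), pd_phi]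
  ring

theorem pd_qv {a : Fin k → Fin k → Euc k → ℝ} (ha : ∀ i j, ContDiff ℝ ∞ (a i j))
    (lam : ℝ) (i : Fin k) (x : Euc k) :
    pd i (qv a lam) x = 4 * lam ^ 2 * phi lam x ^ 2 * (-4 * lam * bv a x * x i + pd i (bv a) x) := by
  have h2 := (bv_contDiff ha).dat x
  have h3 := (phi_contDiff (k := k) lam).dat x
  unfold qv
  rw [pd_const_mul _ (by fun_prop), pd_mul (by fun_prop) (by fun_prop),
    pd_mul (by fun_prop) (by fun_prop), pd_phi]
  ring

/-- auxiliary sums -/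
def sS (a : Fin k → Fin k → Euc k → ℝ) (w : Euc k → ℝ) (x : Euc k) : ℝ :=
  ∑ m, yv a m x * pd m w x
def tT1 (a : Fin k → Fin k → Euc k → ℝ) (w : Euc k → ℝ) (x : Euc k) : ℝ :=
  ∑ i, ∑ m, flux a w i x * pd i (yv a m) x * pd m w x
def tT2 (a : Fin k → Fin k → Euc k → ℝ) (w : Euc k → ℝ) (x : Euc k) : ℝ :=
  ∑ m, ∑ i, ∑ j, yv a m x * pd m (a i j) x * pd j w x * pd i w x
def dY (a : Fin k → Fin k → Euc k → ℝ) (x : Euc k) : ℝ := ∑ i, pd i (yv a i) x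
def yB (a : Fin k → Fin k → Euc k → ℝ) (x : Euc k) : ℝ := ∑ i, yv a i x * pd i (bv a) x
def fB (a : Fin k → Fin k → Euc k → ℝ) (w : Euc k → ℝ) (x : Euc k) : ℝ :=
  ∑ i, flux a w i x * pd i (bv a) x

theorem flux_x {a : Fin k → Fin k → Euc k → ℝ} (hs : ∀ i j, a i j = a j i)
    (w : Euc k → ℝ) (x : Euc k) : ∑ i, flux a w i x * x i = sS a w x := by
  simp only [flux, sS, yv, Finset.sum_mul]
  rw [Finset.sum_comm]
  refine Finset.sum_congr rfl fun i _ => Finset.sum_congr rfl fun j _ => ?_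
  rw [hs i j]; ring

theorem divX {a : Fin k → Fin k → Euc k → ℝ} (ha : ∀ i j, ContDiff ℝ ∞ (a i j))
    (lam : ℝ) (x : Euc k) :
    ∑ i, pd i (Xv a lam i) x = 4 * lam ^ 2 * phi lam x * bv a x - 2 * lam * phi lam x * dY a x := by
  simp only [pd_Xv ha, Finset.sum_sub_distrib, bv, dY, Finset.mul_sum]

theorem Q_eq {a : Fin k → Fin k → Euc k → ℝ} (ha : ∀ i j, ContDiff ℝ ∞ (a i j))
    (hs : ∀ i j, a i j = a j i) (lam τ : ℝ) (w : Euc k → ℝ) (x : Euc k) :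
    Qform a (Xv a lam) (gv a lam) (qv a lam) τ w x =
      2 * τ * (8 * lam ^ 2 * phi lam x * sS a w x ^ 2 + 4 * lam ^ 2 * phi lam x * bv a x * en a w x
       + 2 * lam * phi lam x * (-2 * tT1 a w x + dY a x * en a w x + tT2 a w x)
       + w x * (8 * lam ^ 2 * phi lam x * (-2 * lam * bv a x * sS a w x + fB a w x))
       + τ ^ 2 * (16 * lam ^ 4 * phi lam x ^ 3 * bv a x ^ 2
          - 8 * lam ^ 3 * phi lam x ^ 3 * (yB a x + bv a x * dY a x)) * w x ^ 2) := by
  have h1 : tDX a (Xv a lam) w x = 4 * lam ^ 2 * phi lam x * sS a w x ^ 2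
      - 2 * lam * phi lam x * tT1 a w x := by
    have : sS a w x ^ 2 = ∑ i, ∑ m, flux a w i x * x i * (yv a m x * pd m w x) := by
      rw [sq]; nth_rw 1 [← flux_x hs w x]; unfold sS; rw [Finset.sum_mul_sum]
    rw [this]
    simp only [tDX, tT1, Finset.mul_sum, ← Finset.sum_sub_distrib, pd_Xv ha]
    refine Finset.sum_congr rfl fun i _ => Finset.sum_congr rfl fun m _ => by ring
  have h2 : tDA a (Xv a lam) w x = -2 * lam * phi lam x * tT2 a w x := by
    simp only [tDA, tT2, Xv, Finset.mul_sum]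
    refine Finset.sum_congr rfl fun i _ => Finset.sum_congr rfl fun m _ =>
      Finset.sum_congr rfl fun m _ => by ring
  have h3 : ∑ i, flux a w i x * pd i (gv a lam) x =
      8 * lam ^ 2 * phi lam x * (-2 * lam * bv a x * sS a w x + fB a w x) := by
    rw [← flux_x hs w x]
    simp only [fB, Finset.mul_sum, ← Finset.sum_add_distrib, pd_gv ha]
    refine Finset.sum_congr rfl fun i _ => by ring
  have h4 : ∑ i, (pd i (qv a lam) x * Xv a lam i x + qv a lam x * pd i (Xv a lam i) x) =
      48 * lam ^ 4 * phi lam x ^ 3 * bv a x ^ 2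
          - 8 * lam ^ 3 * phi lam x ^ 3 * (yB a x + bv a x * dY a x) := by
    rw [Finset.sum_add_distrib, ← Finset.mul_sum, divX ha]
    have : ∑ i, pd i (qv a lam) x * Xv a lam i x = 32 * lam ^ 4 * phi lam x ^ 3 * bv a x * bv a x
        - 8 * lam ^ 3 * phi lam x ^ 3 * yB a x := by
      nth_rw 2 [bv]
      simp only [yB, Finset.mul_sum, ← Finset.sum_sub_distrib, pd_qv ha, Xv]
      refine Finset.sum_congr rfl fun i _ => by ring
    rw [this, qv]; ring
  unfold Qform
  rw [h1, h2, h3, h4, divX ha, gv, qv]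
  ring

end weight

section bounds
variable {k : ℕ}

theorem abs_sum_le' {f : Fin k → ℝ} {B : ℝ} (h : ∀ i, |f i| ≤ B) : |∑ i, f i| ≤ k * B := by
  calc |∑ i, f i| ≤ ∑ i, |f i| := Finset.abs_sum_le_sum_abs _ _
    _ ≤ ∑ _i : Fin k, B := Finset.sum_le_sum fun i _ => h i
    _ = k * B := by simp

theorem abs_mul_le' {a b A B : ℝ} (ha : |a| ≤ A) (hb : |b| ≤ B) : |a * b| ≤ A * B := by
  rw [abs_mul]
  exact mul_le_mul ha hb (abs_nonneg _) ((abs_nonneg _).trans ha)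

theorem abs_add_le' {a b A B : ℝ} (ha : |a| ≤ A) (hb : |b| ≤ B) : |a + b| ≤ A + B :=
  (abs_add_le a b).trans (add_le_add ha hb)

theorem coord_le (x : Euc k) (i : Fin k) : |x i| ≤ ‖x‖ := by
  simpa using PiLp.norm_apply_le x i

/-- coefficient bounds -/
theorem coef_bounds {Λ L R : ℝ} (hΛ : 0 ≤ Λ) (hL : 0 ≤ L) (hR : 0 ≤ R) :
    ∃ M : ℝ, 1 ≤ M ∧ ∀ a : Fin k → Fin k → Euc k → ℝ, Ell Λ L a → ∀ x : Euc k, ‖x‖ ≤ R →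
      (∀ i j, |a i j x| ≤ M) ∧ (∀ m i j, |pd m (a i j) x| ≤ M) ∧ (∀ m, |yv a m x| ≤ M) ∧
      (∀ i m, |pd i (yv a m) x| ≤ M) ∧ |bv a x| ≤ M ∧ (∀ i, |pd i (bv a) x| ≤ M) := by
  set M1 := (k:ℝ) * (Λ * R)
  set M2 := (k:ℝ) * (L * R) + Λ
  set M3 := (k:ℝ) * (R * M1)
  set M4 := M1 + (k:ℝ) * (R * M2)
  have p1 : 0 ≤ M1 := by positivity
  have p2 : 0 ≤ M2 := by positivity
  have p3 : 0 ≤ M3 := by positivity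
  have p4 : 0 ≤ M4 := by positivity
  refine ⟨1 + Λ + L + M1 + M2 + M3 + M4, by linarith, fun a h x hx => ?_⟩
  have hc : ∀ i, |x i| ≤ R := fun i => (coord_le x i).trans hx
  have hy : ∀ m, |yv a m x| ≤ M1 := fun m =>
    abs_sum_le' fun j => abs_mul_le' (h.bound m j x) (hc j)
  have hdy : ∀ i m, |pd i (yv a m) x| ≤ M2 := by
    intro i m
    rw [pd_yv h.smooth]
    exact abs_add_le' (abs_sum_le' fun j => abs_mul_le' (h.dbound _ _ _ x) (hc j)) (h.bound m i x)
  have hb : |bv a x| ≤ M3 := abs_sum_le' fun j => abs_mul_le' (hc j) (hy j)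
  have hdb : ∀ i, |pd i (bv a) x| ≤ M4 := by
    intro i
    rw [pd_bv h.smooth]
    exact abs_add_le' (hy i) (abs_sum_le' fun j => abs_mul_le' (hc j) (hdy i j))
  refine ⟨fun i j => (h.bound i j x).trans (by linarith),
    fun m i j => (h.dbound m i j x).trans (by linarith), fun m => (hy m).trans (by linarith),
    fun i m => (hdy i m).trans (by linarith), hb.trans (by linarith),
    fun i => (hdb i).trans (by linarith)⟩

def gn (w : Euc k → ℝ) (x : Euc k) : ℝ := Real.sqrt (∑ i, pd i w x ^ 2)

theorem gn_nonneg (w : Euc k → ℝ) (x : Euc k) : 0 ≤ gn w x := Real.sqrt_nonneg _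

theorem gn_sq (w : Euc k → ℝ) (x : Euc k) : gn w x ^ 2 = ∑ i, pd i w x ^ 2 :=
  Real.sq_sqrt (Finset.sum_nonneg fun _ _ => sq_nonneg _)

theorem pd_le_gn (w : Euc k → ℝ) (x : Euc k) (i : Fin k) : |pd i w x| ≤ gn w x := by
  apply Real.abs_le_sqrt
  exact Finset.single_le_sum (f := fun i => pd i w x ^ 2) (fun _ _ => sq_nonneg _)
    (Finset.mem_univ i)

theorem en_lower {Λ L : ℝ} {a : Fin k → Fin k → Euc k → ℝ} (h : Ell Λ L a) (w : Euc k → ℝ)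
    (x : Euc k) : Λ⁻¹ * gn w x ^ 2 ≤ en a w x := by
  rw [gn_sq]
  refine (h.lower x (fun i => pd i w x)).trans (le_of_eq ?_)
  simp only [en, flux, Finset.sum_mul]

theorem norm_sq_sum (x : Euc k) : ∑ i, x i ^ 2 = ‖x‖ ^ 2 := by
  rw [EuclideanSpace.norm_sq_eq]; simp

theorem bv_lower {Λ L : ℝ} {a : Fin k → Fin k → Euc k → ℝ} (h : Ell Λ L a)
    (x : Euc k) : Λ⁻¹ * ‖x‖ ^ 2 ≤ bv a x := by
  rw [← norm_sq_sum]
  refine (h.lower x (fun i => x i)).trans (le_of_eq ?_)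
  simp only [bv, yv, Finset.mul_sum]
  refine Finset.sum_congr rfl fun i _ => Finset.sum_congr rfl fun m _ => by ring

theorem phi_eq (lam : ℝ) (x : Euc k) : phi lam x = Real.exp (-lam * ‖x‖ ^ 2) := by
  rw [← norm_sq_sum, phi]; simp only [sq]

theorem phi_pos (lam : ℝ) (x : Euc k) : 0 < phi lam x := Real.exp_pos _

theorem phi_le_one {lam : ℝ} (h : 0 ≤ lam) (x : Euc k) : phi lam x ≤ 1 := by
  rw [phi_eq, Real.exp_le_one_iff]
  have : 0 ≤ lam * ‖x‖ ^ 2 := by positivity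
  linarith

/-- bounds for the auxiliary sums -/
theorem sum_bounds {Λ L R : ℝ} (hΛ : 0 ≤ Λ) (hL : 0 ≤ L) (hR : 0 ≤ R) :
    ∃ M : ℝ, 1 ≤ M ∧ ∀ a : Fin k → Fin k → Euc k → ℝ, Ell Λ L a → ∀ w : Euc k → ℝ,
      ∀ x : Euc k, ‖x‖ ≤ R →
      |-2 * tT1 a w x + dY a x * en a w x + tT2 a w x| ≤ M * gn w x ^ 2 ∧
      |yB a x + bv a x * dY a x| ≤ M ∧
      |bv a x * sS a w x| ≤ M * gn w x ∧ |fB a w x| ≤ M * gn w x ∧ |bv a x| ≤ M ∧ |dY a x| ≤ M := by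
  obtain ⟨M, hM1, hM⟩ := coef_bounds (k := k) hΛ hL hR
  have hM0 : 0 ≤ M := by linarith
  set K := (k:ℝ)
  have hK : 0 ≤ K := Nat.cast_nonneg k
  refine ⟨1 + (2 * (K * (K * ((K * M) * M))) + (K * M) * (K * (K * M)) + K * (K * (K * (M * M))))
    + (K * (M * M) + M * (K * M)) + (M * (K * M)) + (K * ((K * M) * M)) + M + K * M,
    by linarith [show 0 ≤ (2 * (K * (K * ((K * M) * M))) + (K * M) * (K * (K * M)) + K * (K * (K * (M * M))))
    + (K * (M * M) + M * (K * M)) + (M * (K * M)) + (K * ((K * M) * M)) + M + K * M by positivity],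
    fun a h w x hx => ?_⟩
  obtain ⟨ba, bda, by', bdy, bb, bdb⟩ := hM a h x hx
  set n := gn w x
  have hn : 0 ≤ n := gn_nonneg w x
  have hw : ∀ i, |pd i w x| ≤ n := pd_le_gn w x
  have hF : ∀ i, |flux a w i x| ≤ K * (M * n) := fun i =>
    abs_sum_le' fun j => abs_mul_le' (ba i j) (hw j)
  have hdY : |dY a x| ≤ K * M := abs_sum_le' fun i => bdy i i
  have hen : |en a w x| ≤ K * (K * (M * n) * n) := abs_sum_le' fun i => abs_mul_le' (hF i) (hw i)
  have hs : |sS a w x| ≤ K * (M * n) := abs_sum_le' fun i => abs_mul_le' (by' i) (hw i)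
  have hT1 : |tT1 a w x| ≤ K * (K * (K * (M * n) * M * n)) := abs_sum_le' fun i => abs_sum_le' fun m =>
    abs_mul_le' (abs_mul_le' (hF i) (bdy i m)) (hw m)
  have hT2 : |tT2 a w x| ≤ K * (K * (K * (M * M * n * n))) := abs_sum_le' fun m => abs_sum_le' fun i =>
    abs_sum_le' fun j => abs_mul_le' (abs_mul_le' (abs_mul_le' (by' m) (bda m i j)) (hw j)) (hw i)
  have hyB : |yB a x| ≤ K * (M * M) := abs_sum_le' fun i => abs_mul_le' (by' i) (bdb i)
  have hfB : |fB a w x| ≤ K * (K * (M * n) * M) := abs_sum_le' fun i => abs_mul_le' (hF i) (bdb i)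
  have e2 : |(-2:ℝ)| ≤ 2 := by norm_num
  have p1 : 0 ≤ 2 * (K * (K * ((K * M) * M))) := by positivity
  have p2 : 0 ≤ (K * M) * (K * (K * M)) := by positivity
  have p3 : 0 ≤ K * (K * (K * (M * M))) := by positivity
  have p4 : 0 ≤ K * (M * M) := by positivity
  have p5 : 0 ≤ M * (K * M) := by positivity
  have p6 : 0 ≤ (K * ((K * M) * M)) := by positivity
  have p7 : 0 ≤ K * M := by positivity
  refine ⟨(abs_add_le' (abs_add_le' (abs_mul_le' e2 hT1) (abs_mul_le' hdY hen)) hT2).trans ?_,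
    (abs_add_le' hyB (abs_mul_le' bb hdY)).trans (by linarith),
    (abs_mul_le' bb hs).trans ?_, hfB.trans ?_, by linarith, by linarith⟩
  · have : 2 * (K * (K * (K * (M * n) * M * n))) + K * M * (K * (K * (M * n) * n)) +
      K * (K * (K * (M * M * n * n))) = (2 * (K * (K * ((K * M) * M))) + (K * M) * (K * (K * M)) + K * (K * (K * (M * M)))) * n ^ 2 := by ring
    rw [this]
    exact mul_le_mul_of_nonneg_right (by linarith) (sq_nonneg n)
  · have : M * (K * (M * n)) = M * (K * M) * n := by ring
    rw [this]
    exact mul_le_mul_of_nonneg_right (by linarith) hn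
  · have : K * (K * (M * n) * M) = (K * ((K * M) * M)) * n := by ring
    rw [this]
    exact mul_le_mul_of_nonneg_right (by linarith) hn

set_option maxHeartbeats 1000000 in
theorem Q_lower {Λ L R ρ : ℝ} (hΛ : 0 < Λ) (hL : 0 ≤ L) (hR : 0 ≤ R) (hρ : 0 < ρ) :
    ∃ lam > 0, ∃ κ > 0, ∃ τ₁ > 0, ∃ M : ℝ, ∀ a : Fin k → Fin k → Euc k → ℝ, Ell Λ L a →
      ∀ w : Euc k → ℝ, ∀ x : Euc k, ρ ≤ ‖x‖ → ‖x‖ ≤ R →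
      |(∑ i, pd i (Xv a lam i) x) - gv a lam x| ≤ M ∧
      ∀ τ, τ₁ ≤ τ → κ * τ ^ 3 * w x ^ 2 ≤ Qform a (Xv a lam) (gv a lam) (qv a lam) τ w x := by
  obtain ⟨M, hM1, hM⟩ := sum_bounds (k := k) hΛ.le hL hR
  set c := Λ⁻¹ * ρ ^ 2 with hc
  have hc0 : 0 < c := by positivity
  have hΛi : 0 < Λ⁻¹ := by positivity
  set lam := M / (c * Λ⁻¹) + M / c ^ 2 with hlam
  have hlam0 : 0 < lam := by positivity
  have hl1 : M ≤ lam * (c * Λ⁻¹) := by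
    have : M = M / (c * Λ⁻¹) * (c * Λ⁻¹) := by field_simp
    have h2 : 0 ≤ M / c ^ 2 * (c * Λ⁻¹) := by positivity
    rw [hlam, add_mul]; linarith
  have hl2 : M ≤ lam * c ^ 2 := by
    have : M = M / c ^ 2 * c ^ 2 := by field_simp
    have h2 : 0 ≤ M / (c * Λ⁻¹) * (c ^ 2) := by positivity
    rw [hlam, add_mul]; linarith
  set f0 := Real.exp (-lam * R ^ 2) with hf0
  have hf0p : 0 < f0 := Real.exp_pos _
  set α := 2 * f0 * lam ^ 2 * (c * Λ⁻¹) with hα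
  set γ := 8 * lam ^ 2 * (2 * lam * M + M) with hγ
  set κ := 8 * f0 ^ 3 * lam ^ 4 * c ^ 2 with hκ
  have hαp : 0 < α := by positivity
  have hγp : 0 < γ := by positivity
  have hκp : 0 < κ := by positivity
  refine ⟨lam, hlam0, κ, hκp, 1 + γ ^ 2 / (α * κ), by positivity, 4 * lam ^ 2 * M + 2 * lam * M,
    fun a h w x hx1 hx2 => ?_⟩
  obtain ⟨b1, b2, b3, b4, b5, b6⟩ := hM a h w x hx2
  have hph := phi_pos (k := k) lam x
  have hph1 := phi_le_one (k := k) hlam0.le x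
  have hphl : f0 ≤ phi lam x := by
    rw [phi_eq, hf0]
    apply Real.exp_le_exp.2
    have : ‖x‖ ^ 2 ≤ R ^ 2 := by gcongr
    have := mul_le_mul_of_nonneg_left this hlam0.le
    linarith
  have hb : c ≤ bv a x := by
    refine le_trans ?_ (bv_lower h x)
    rw [hc]; gcongr
  have hen := en_lower h w x
  have hn := gn_nonneg w x
  set n := gn w x
  set p := phi lam x
  constructor
  · rw [divX h.smooth, gv]
    have : 4 * lam ^ 2 * p * bv a x - 2 * lam * p * dY a x - 8 * lam ^ 2 * (p * bv a x) =
      p * (-(4 * lam ^ 2) * bv a x + -(2 * lam) * dY a x) := by ring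
    rw [this]
    calc _ ≤ 1 * ((4 * lam ^ 2) * M + (2 * lam) * M) := by
          refine abs_mul_le' (by rw [abs_of_pos hph]; exact hph1) (abs_add_le' (abs_mul_le' ?_ b5)
            (abs_mul_le' ?_ b6))
          · rw [abs_neg, abs_of_pos (by positivity)]
          · rw [abs_neg, abs_of_pos (by positivity)]
      _ = _ := by ring
  intro τ hτ
  have hτ1 : 1 ≤ τ := le_trans (by linarith [show 0 ≤ γ ^ 2 / (α * κ) by positivity]) hτ
  have hτ2 : γ ^ 2 ≤ τ * (α * κ) := by
    have : γ ^ 2 / (α * κ) ≤ τ := by linarith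
    rwa [div_le_iff₀ (by positivity)] at this
  rw [Q_eq h.smooth h.symm]
  -- gradient part
  have g1 : α * n ^ 2 ≤ 8 * lam ^ 2 * p * sS a w x ^ 2 + 4 * lam ^ 2 * p * bv a x * en a w x
       + 2 * lam * p * (-2 * tT1 a w x + dY a x * en a w x + tT2 a w x) := by
    have t1 : 0 ≤ 8 * lam ^ 2 * p * sS a w x ^ 2 := by positivity
    have t2 : c * (Λ⁻¹ * n ^ 2) ≤ bv a x * en a w x :=
      mul_le_mul hb hen (by positivity) (by linarith)
    have t3 := (abs_le.1 b1).1
    have t4 : M * n ^ 2 ≤ lam * (c * Λ⁻¹) * n ^ 2 := by gcongr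
    have t5 : 2 * lam * p * (-(lam * (c * Λ⁻¹) * n ^ 2)) ≤
      2 * lam * p * (-2 * tT1 a w x + dY a x * en a w x + tT2 a w x) :=
      mul_le_mul_of_nonneg_left (by linarith) (by positivity)
    have t6 : 4 * lam ^ 2 * p * (c * (Λ⁻¹ * n ^ 2)) ≤ 4 * lam ^ 2 * p * (bv a x * en a w x) :=
      mul_le_mul_of_nonneg_left t2 (by positivity)
    have t7 : f0 * (2 * lam ^ 2 * (c * Λ⁻¹) * n ^ 2) ≤ p * (2 * lam ^ 2 * (c * Λ⁻¹) * n ^ 2) :=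
      mul_le_mul_of_nonneg_right hphl (by positivity)
    rw [hα]
    linear_combination t1 + t5 + t6 + t7
  have g2 : κ ≤ 16 * lam ^ 4 * p ^ 3 * bv a x ^ 2
          - 8 * lam ^ 3 * p ^ 3 * (yB a x + bv a x * dY a x) := by
    have t1 : c ^ 2 ≤ bv a x ^ 2 := by gcongr
    have t2 := (abs_le.1 b2).2
    have t3 : 16 * lam ^ 4 * p ^ 3 * c ^ 2 ≤ 16 * lam ^ 4 * p ^ 3 * bv a x ^ 2 := by gcongr
    have t4 : 8 * lam ^ 3 * p ^ 3 * (yB a x + bv a x * dY a x) ≤ 8 * lam ^ 3 * p ^ 3 * (lam * c ^ 2) :=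
      mul_le_mul_of_nonneg_left (by linarith) (by positivity)
    have t5 : f0 ^ 3 * (8 * lam ^ 4 * c ^ 2) ≤ p ^ 3 * (8 * lam ^ 4 * c ^ 2) := by gcongr
    rw [hκ]
    linear_combination t3 + t4 + t5
  have g3 : |8 * lam ^ 2 * p * (-2 * lam * bv a x * sS a w x + fB a w x)| ≤ γ * n := by
    have : 8 * lam ^ 2 * p * (-2 * lam * bv a x * sS a w x + fB a w x) =
      (8 * lam ^ 2) * (p * (-(2 * lam) * (bv a x * sS a w x) + fB a w x)) := by ring
    rw [this]
    calc _ ≤ (8 * lam ^ 2) * (1 * ((2 * lam) * (M * n) + M * n)) := by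
          refine abs_mul_le' (by rw [abs_of_pos (by positivity)])
            (abs_mul_le' (by rw [abs_of_pos hph]; exact hph1) (abs_add_le' (abs_mul_le' ?_ b3) b4))
          rw [abs_neg, abs_of_pos (by positivity)]
      _ = γ * n := by rw [hγ]; ring
  set W := 8 * lam ^ 2 * p * (-2 * lam * bv a x * sS a w x + fB a w x)
  have g4 : -(γ * n * |w x|) ≤ w x * W := by
    have := abs_mul_le' g3 (le_refl |w x|)
    rw [mul_comm W] at this
    exact (abs_le.1 this).1
  have g5 : τ ^ 2 * κ * w x ^ 2 ≤ τ ^ 2 * (16 * lam ^ 4 * p ^ 3 * bv a x ^ 2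
          - 8 * lam ^ 3 * p ^ 3 * (yB a x + bv a x * dY a x)) * w x ^ 2 := by gcongr
  -- complete the square
  have g6 : γ * n * |w x| ≤ α * n ^ 2 + τ ^ 2 * κ / 2 * w x ^ 2 := by
    have s1 : γ ^ 2 / (2 * α) ≤ τ ^ 2 * κ / 2 := by
      rw [div_le_div_iff₀ (by positivity) (by positivity)]
      have : τ * (α * κ) ≤ τ ^ 2 * (α * κ) := by
        have : τ ≤ τ ^ 2 := le_self_pow₀ hτ1 two_ne_zero
        gcongr
      linear_combination 2 * hτ2 + 2 * this
    have s2 : γ * n * |w x| ≤ α * n ^ 2 + γ ^ 2 / (2 * α) * |w x| ^ 2 := by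
      have : γ * n * |w x| = α * n ^ 2 + γ ^ 2 / (4 * α) * |w x| ^ 2 - α * (n - γ * |w x| / (2 * α)) ^ 2 := by
        field_simp; ring
      have z1 : 0 ≤ α * (n - γ * |w x| / (2 * α)) ^ 2 := by positivity
      have z2 : γ ^ 2 / (4 * α) * |w x| ^ 2 ≤ γ ^ 2 / (2 * α) * |w x| ^ 2 := by
        gcongr; norm_num
      linarith
    rw [sq_abs] at s2
    have : γ ^ 2 / (2 * α) * w x ^ 2 ≤ τ ^ 2 * κ / 2 * w x ^ 2 := by gcongr
    linarith
  calc κ * τ ^ 3 * w x ^ 2 = 2 * τ * (τ ^ 2 * κ / 2 * w x ^ 2) := by ring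
    _ ≤ _ := by
      apply mul_le_mul_of_nonneg_left _ (by linarith)
      linarith

end bounds

section carl
variable {k : ℕ}

def Ew (lam τ : ℝ) (x : Euc k) : ℝ := Real.exp (τ * phi lam x)

theorem Ew_contDiff (lam τ : ℝ) : ContDiff ℝ ∞ (Ew (k := k) lam τ) :=
  Real.contDiff_exp.comp (contDiff_const.mul (phi_contDiff lam))

theorem Ew_pos (lam τ : ℝ) (x : Euc k) : 0 < Ew lam τ x := Real.exp_pos _

theorem pd_Ew (lam τ : ℝ) (i : Fin k) (x : Euc k) :
    pd i (Ew lam τ) x = Ew lam τ x * (τ * pd i (phi lam) x) := by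
  have h := (phi_contDiff (k := k) lam).dat x
  unfold Ew
  rw [pd_exp (h.const_mul _), pd_const_mul _ h]

theorem Xv_flux (a : Fin k → Fin k → Euc k → ℝ) (lam : ℝ) (i : Fin k) (x : Euc k) :
    flux a (phi lam) i x = Xv a lam i x := by
  simp only [flux, Xv, yv, pd_phi, Finset.mul_sum]
  exact Finset.sum_congr rfl fun j _ => by ring

theorem flux_conj {a : Fin k → Fin k → Euc k → ℝ} (lam τ : ℝ)
    {u : Euc k → ℝ} (hu : ContDiff ℝ ∞ u) (i : Fin k) (x : Euc k) :
    flux a (fun y => Ew lam τ y * u y) i x =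
      Ew lam τ x * (flux a u i x + τ * (u x * Xv a lam i x)) := by
  rw [← Xv_flux]
  simp only [flux, Finset.mul_sum, ← Finset.sum_add_distrib]
  refine Finset.sum_congr rfl fun j _ => ?_
  rw [pd_mul ((Ew_contDiff lam τ).dat x) (hu.dat x), pd_Ew]
  ring

theorem conj_ident {a : Fin k → Fin k → Euc k → ℝ} (ha : ∀ i j, ContDiff ℝ ∞ (a i j))
    (hs : ∀ i j, a i j = a j i) (lam τ : ℝ)
    {u : Euc k → ℝ} (hu : ContDiff ℝ ∞ u) (x : Euc k) :
    Lop a (fun y => Ew lam τ y * u y) x + τ ^ 2 * qv a lam x * (Ew lam τ x * u x)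
      - 2 * τ * dirD (Xv a lam) (fun y => Ew lam τ y * u y) x =
    Ew lam τ x * (Lop a u x + τ * u x * ∑ i, pd i (Xv a lam i) x) := by
  have hE := (Ew_contDiff (k := k) lam τ).dat x
  have hu' := hu.dat x
  have hX := fun i => (Xv_contDiff ha lam i).dat x
  have hF := fun i => (flux_contDiff ha hu i).dat x
  have hZ : ∑ i, pd i (phi lam) x * flux a u i x = dirD (Xv a lam) u x := by
    have := flux_x hs u x
    simp only [pd_phi, dirD, Xv]
    have e1 : ∑ i, -2 * lam * x i * phi lam x * flux a u i x =
      -2 * lam * phi lam x * ∑ i, flux a u i x * x i := by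
      rw [Finset.mul_sum]; exact Finset.sum_congr rfl fun j _ => by ring
    rw [e1, this, sS, Finset.mul_sum]; exact Finset.sum_congr rfl fun j _ => by ring
  have hq : ∑ i, pd i (phi lam) x * Xv a lam i x = qv a lam x := by
    simp only [pd_phi, qv, Xv, bv, Finset.mul_sum]
    exact Finset.sum_congr rfl fun j _ => by ring
  have hD : dirD (Xv a lam) (fun y => Ew lam τ y * u y) x =
      Ew lam τ x * (τ * qv a lam x * u x + dirD (Xv a lam) u x) := by
    rw [← hq]
    simp only [dirD, Finset.mul_sum, Finset.sum_mul, ← Finset.sum_add_distrib]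
    refine Finset.sum_congr rfl fun j _ => ?_
    rw [pd_mul hE hu', pd_Ew]; ring
  have hp : ∀ i, pd i (flux a (fun y => Ew lam τ y * u y) i) x =
      Ew lam τ x * (τ * (pd i (phi lam) x * flux a u i x)
        + τ ^ 2 * u x * (pd i (phi lam) x * Xv a lam i x)
        + pd i (flux a u i) x + τ * (Xv a lam i x * pd i u x) + τ * u x * pd i (Xv a lam i) x) := by
    intro i
    have : flux a (fun y => Ew lam τ y * u y) i =
      fun x => Ew lam τ x * (flux a u i x + τ * (u x * Xv a lam i x)) :=
      funext fun x => flux_conj lam τ hu i x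
    have := hX i
    have := hF i
    rw [‹flux a (fun y => Ew lam τ y * u y) i = _›, pd_mul hE (by fun_prop),
      pd_add (by fun_prop) (by fun_prop), pd_const_mul _ (by fun_prop),
      pd_mul (by fun_prop) (by fun_prop), pd_Ew]
    ring
  have hL : Lop a (fun y => Ew lam τ y * u y) x =
      Ew lam τ x * (τ * dirD (Xv a lam) u x + τ ^ 2 * u x * qv a lam x + Lop a u x
        + τ * dirD (Xv a lam) u x + τ * u x * ∑ i, pd i (Xv a lam i) x) := by
    nth_rw 1 [← hZ]
    rw [← hq]
    unfold Lop dirD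
    simp only [hp, Finset.mul_sum, ← Finset.sum_add_distrib]
  rw [hL, hD]; ring

theorem carleman {Λ L R ρ : ℝ} (hΛ : 0 < Λ) (hL : 0 ≤ L) (hR : 0 ≤ R) (hρ : 0 < ρ) :
    ∃ lam > 0, ∃ τ₁ > 0, ∀ a : Fin k → Fin k → Euc k → ℝ, Ell Λ L a →
      ∀ u : Euc k → ℝ, ContDiff ℝ ∞ u → HasCompactSupport u →
      (∀ x ∈ tsupport u, ρ ≤ ‖x‖ ∧ ‖x‖ ≤ R) → ∀ τ, τ₁ ≤ τ →
      ∫ x, (Ew lam τ x * u x) ^ 2 ≤ 2 * ∫ x, (Ew lam τ x * Lop a u x) ^ 2 := by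
  obtain ⟨lam, hlam, κ, hκ, τ₁, hτ₁, M, hQ⟩ := Q_lower (k := k) hΛ hL hR hρ
  refine ⟨lam, hlam, 1 + τ₁ + (2 * M ^ 2 + 1) / κ, by positivity, fun a h u hu hc hsu τ hτ => ?_⟩
  have hk0 : 0 ≤ (2 * M ^ 2 + 1) / κ := by positivity
  have hτ1 : 1 ≤ τ := by linarith
  have hττ : τ₁ ≤ τ := by linarith
  have hτκ : 2 * M ^ 2 + 1 ≤ τ * κ := by
    have : (2 * M ^ 2 + 1) / κ ≤ τ := by linarith
    rwa [div_le_iff₀ hκ] at this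
  set w : Euc k → ℝ := fun y => Ew lam τ y * u y with hw
  have hwc : ContDiff ℝ ∞ w := (Ew_contDiff lam τ).mul hu
  have hts : tsupport w ⊆ tsupport u := tsupport_mul_subset_right
  have hcw : HasCompactSupport w := hc.mul_left
  obtain ⟨i1, i2, i3⟩ := ident_int h.smooth h.symm (Xv_contDiff h.smooth lam)
    (gv_contDiff h.smooth lam) (qv_contDiff h.smooth lam) τ hwc hcw
  have hLc := (Lop_contDiff h.smooth hu).continuous
  have hEc := (Ew_contDiff (k := k) lam τ).continuous
  have j1 : Integrable (fun x => (w x) ^ 2) := by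
    refine Continuous.integrable_of_hasCompactSupport (hwc.continuous.pow 2)
      (hcs_of_eq hcw fun x hx => ?_)
    simp [image_eq_zero_of_notMem_tsupport hx]
  have j2 : Integrable (fun x => (Ew lam τ x * Lop a u x) ^ 2) := by
    refine Continuous.integrable_of_hasCompactSupport (by fun_prop)
      (hcs_of_eq hc fun x hx => ?_)
    simp [Lop_zero_of hx]
  have low : κ * τ ^ 3 * ∫ x, w x ^ 2 ≤ ∫ x, Qform a (Xv a lam) (gv a lam) (qv a lam) τ w x := by
    rw [← integral_const_mul]
    refine integral_mono (j1.const_mul _) i2 fun x => ?_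
    by_cases hx : x ∈ tsupport w
    · obtain ⟨h1, h2⟩ := hsu x (hts hx)
      exact (hQ a h w x h1 h2).2 τ hττ
    · simp [Qform_zero_of hx, image_eq_zero_of_notMem_tsupport hx]
  have up : ∫ x, 2 * (Lop a w x + τ ^ 2 * qv a lam x * w x) *
        (-2 * τ * dirD (Xv a lam) w x - τ * gv a lam x * w x) ≤
      2 * (∫ x, (Ew lam τ x * Lop a u x) ^ 2) + 2 * τ ^ 2 * M ^ 2 * ∫ x, w x ^ 2 := by
    rw [← integral_const_mul, ← integral_const_mul, ← integral_add (j2.const_mul _) (j1.const_mul _)]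
    refine integral_mono i1 ((j2.const_mul _).add (j1.const_mul _)) fun x => ?_
    by_cases hx : x ∈ tsupport w
    · obtain ⟨h1, h2⟩ := hsu x (hts hx)
      have hb := (hQ a h w x h1 h2).1
      have hci := conj_ident h.smooth h.symm lam τ hu x
      set D := (∑ i, pd i (Xv a lam i) x)
      set S := Lop a w x + τ ^ 2 * qv a lam x * w x
      set K := -2 * τ * dirD (Xv a lam) w x - τ * gv a lam x * w x
      have e1 : S + K = Ew lam τ x * Lop a u x + τ * (D - gv a lam x) * w x := by
        have : S - 2 * τ * dirD (Xv a lam) w x = Ew lam τ x * (Lop a u x + τ * u x * D) := hci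
        have h3 : w x = Ew lam τ x * u x := rfl
        simp only [K]
        rw [h3] at *
        linear_combination this
      have e2 : (D - gv a lam x) ^ 2 ≤ M ^ 2 := sq_le_sq' (abs_le.1 hb).1 (abs_le.1 hb).2
      have e3 : τ ^ 2 * w x ^ 2 * (D - gv a lam x) ^ 2 ≤ τ ^ 2 * w x ^ 2 * M ^ 2 := by gcongr
      have e4 : 2 * S * K ≤ (S + K) ^ 2 := by nlinarith [sq_nonneg S, sq_nonneg K]
      rw [e1] at e4
      refine e4.trans ?_
      show (Ew lam τ x * Lop a u x + τ * (D - gv a lam x) * w x) ^ 2 ≤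
        2 * (Ew lam τ x * Lop a u x) ^ 2 + 2 * τ ^ 2 * M ^ 2 * w x ^ 2
      nlinarith [sq_nonneg (Ew lam τ x * Lop a u x - τ * (D - gv a lam x) * w x)]
    · simp only [Lop_zero_of hx, image_eq_zero_of_notMem_tsupport hx]
      have := sq_nonneg (Ew lam τ x * Lop a u x)
      simp; positivity
  rw [i3] at up
  have hI : 0 ≤ ∫ x, w x ^ 2 := integral_nonneg fun x => sq_nonneg _
  set I := ∫ x, w x ^ 2
  have h1 : 1 ≤ κ * τ ^ 3 - 2 * τ ^ 2 * M ^ 2 := by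
    have : τ ^ 2 * (2 * M ^ 2 + 1) ≤ τ ^ 2 * (τ * κ) := by gcongr
    have h2 : 1 ≤ τ ^ 2 := one_le_pow₀ hτ1
    linarith
  have h2 : 1 * I ≤ (κ * τ ^ 3 - 2 * τ ^ 2 * M ^ 2) * I := by gcongr
  linarith

end carl

section cacc
variable {k : ℕ}

theorem intOn_ball {F : Euc k → ℝ} (hF : Continuous F) (r : ℝ) :
    IntegrableOn F (ball (0 : Euc k) r) :=
  (hF.continuousOn.integrableOn_compact (isCompact_closedBall _ _)).mono_set ball_subset_closedBall

theorem intOn_cball {F : Euc k → ℝ} (hF : Continuous F) (r : ℝ) :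
    IntegrableOn F (closedBall (0 : Euc k) r) :=
  hF.continuousOn.integrableOn_compact (isCompact_closedBall _ _)

theorem bdd_fam {ι : Type*} [Finite ι] {F : ι → Euc k → ℝ} (hF : ∀ i, Continuous (F i))
    (hc : ∀ i, HasCompactSupport (F i)) : ∃ D : ℝ, 0 ≤ D ∧ ∀ i x, |F i x| ≤ D := by
  have := Fintype.ofFinite ι
  choose D hD using fun i => (hF i).bounded_above_of_compact_support (hc i)
  refine ⟨∑ i, |D i|, by positivity, fun i x => (hD i x).trans ((le_abs_self _).trans ?_)⟩
  exact Finset.single_le_sum (f := fun i => |D i|) (fun _ _ => abs_nonneg _) (Finset.mem_univ i)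

theorem gn_sq_cont {v : Euc k → ℝ} (hv : ContDiff ℝ ∞ v) : Continuous (fun x => gn v x ^ 2) := by
  simp only [gn_sq]
  exact continuous_finsetSum _ fun i _ => (pd_contDiff hv i).continuous.pow 2

theorem flux_le {Λ L : ℝ} {a : Fin k → Fin k → Euc k → ℝ} (h : Ell Λ L a) (w : Euc k → ℝ)
    (i : Fin k) (x : Euc k) : |flux a w i x| ≤ k * (Λ * gn w x) :=
  abs_sum_le' fun j => abs_mul_le' (h.bound i j x) (pd_le_gn w x j)

theorem caccio {Λ L ρ r : ℝ} (hΛ : 0 < Λ) (hρ : 0 < ρ) (hr : ρ < r) :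
    ∃ C > 0, ∀ a : Fin k → Fin k → Euc k → ℝ, Ell Λ L a → ∀ v : Euc k → ℝ, ContDiff ℝ ∞ v →
      ∫ x in closedBall (0 : Euc k) ρ, gn v x ^ 2 ≤
        C * ∫ x in ball (0 : Euc k) r, (v x ^ 2 + Lop a v x ^ 2) := by
  let b : ContDiffBump (0 : Euc k) := ⟨ρ, r, hρ, hr⟩
  set η : Euc k → ℝ := fun x => b x with hη
  have hηc : ContDiff ℝ ∞ η := b.contDiff
  have hηs : HasCompactSupport η := b.hasCompactSupport
  obtain ⟨D, hD0, hD⟩ := bdd_fam (fun i => (pd_contDiff hηc i).continuous)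
    (fun i => pd_hasCompactSupport hηs i)
  set K : ℝ := k * (k * Λ * D) with hK
  have hK0 : 0 ≤ K := by positivity
  refine ⟨2 * Λ * (2 * Λ * K ^ 2 + 1), by positivity, fun a h v hv => ?_⟩
  set f := Lop a v with hf
  have hfc : ContDiff ℝ ∞ f := Lop_contDiff h.smooth hv
  set F : Fin k → Euc k → ℝ := fun i y => (η y * η y) * (v y * flux a v i y) with hF
  have hfl := fun i => flux_contDiff h.smooth hv i
  have hFc : ∀ i, ContDiff ℝ ∞ (F i) := fun i => (hηc.mul hηc).mul (hv.mul (hfl i))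
  have hFs : ∀ i, HasCompactSupport (F i) := fun i => (hηs.mul_left).mul_right
  have hJ : ∫ x, ∑ i, pd i (F i) x = 0 := by
    rw [integral_finsetSum]
    · exact Finset.sum_eq_zero fun i _ => integral_pd (hFc i) (hFs i) i
    · exact fun i _ => (pd_contDiff (hFc i) i).continuous.integrable_of_hasCompactSupport
        (pd_hasCompactSupport (hFs i) i)
  have hJi : Integrable fun x => ∑ i, pd i (F i) x :=
    integrable_finsetSum _ fun i _ =>
      (pd_contDiff (hFc i) i).continuous.integrable_of_hasCompactSupport
        (pd_hasCompactSupport (hFs i) i)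
  have hJe : ∀ x, ∑ i, pd i (F i) x = η x ^ 2 * en a v x
      + 2 * η x * v x * (∑ i, flux a v i x * pd i η x) + η x ^ 2 * v x * f x := by
    intro x
    simp only [hf, en, Lop, Finset.mul_sum, ← Finset.sum_add_distrib]
    refine Finset.sum_congr rfl fun i _ => ?_
    have e1 := hηc.dat x
    have e2 := hv.dat x
    have e3 := (hfl i).dat x
    simp only [hF]
    rw [pd_mul (F := fun y => η y * η y) (G := fun y => v y * flux a v i y) (e1.mul e1) (e2.mul e3),
      pd_mul e1 e1, pd_mul e2 e3]
    ring
  have hpt : ∀ x, 1 / (2 * Λ) * (η x ^ 2 * gn v x ^ 2) - ∑ i, pd i (F i) x ≤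
      (ball (0 : Euc k) r).indicator (fun x => (2 * Λ * K ^ 2 + 1) * (v x ^ 2 + f x ^ 2)) x := by
    intro x
    rw [hJe]
    by_cases hx : x ∈ ball (0 : Euc k) r
    · rw [indicator_of_mem hx]
      have e1 := en_lower h v x
      have e2 : |∑ i, flux a v i x * pd i η x| ≤ K * gn v x := by
        refine (abs_sum_le' fun i => abs_mul_le' (flux_le h v i x) (hD i x)).trans ?_
        rw [hK]; apply le_of_eq; ring
      have h0 : 0 ≤ η x := b.nonneg
      have h1 : η x ≤ 1 := b.le_one
      set S := ∑ i, flux a v i x * pd i η x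
      set g := gn v x
      have hg : 0 ≤ g := gn_nonneg v x
      have e3 : η x ^ 2 * (Λ⁻¹ * g ^ 2) ≤ η x ^ 2 * en a v x := by gcongr
      have e4 : |2 * η x * v x * S| ≤ 2 * η x * |v x| * (K * g) := by
        rw [abs_mul, abs_mul, abs_mul, abs_of_nonneg h0, abs_two]
        gcongr
      have e5 : 2 * η x * |v x| * (K * g) ≤ 1 / (2 * Λ) * (η x ^ 2 * g ^ 2)
          + 2 * Λ * K ^ 2 * v x ^ 2 := by
        have : 1 / (2 * Λ) * (η x ^ 2 * g ^ 2) + 2 * Λ * K ^ 2 * v x ^ 2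
          - 2 * η x * |v x| * (K * g) = 1 / (2 * Λ) * (η x * g - 2 * Λ * K * |v x|) ^ 2 := by
          rw [← sq_abs (v x)]; field_simp; ring
        have h2 : 0 ≤ 1 / (2 * Λ) * (η x * g - 2 * Λ * K * |v x|) ^ 2 := by positivity
        linarith
      have e6 : -(v x ^ 2 + f x ^ 2) ≤ η x ^ 2 * v x * f x := by
        have h2 : η x ^ 2 ≤ 1 := pow_le_one₀ h0 h1
        nlinarith [sq_nonneg (v x + f x), sq_nonneg (v x), sq_nonneg (f x),
          mul_nonneg (sub_nonneg.2 h2) (add_nonneg (sq_nonneg (v x)) (sq_nonneg (f x))),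
          mul_nonneg (sq_nonneg (η x)) (sq_nonneg (v x + f x))]
      have e7 : Λ⁻¹ = 1 / (2 * Λ) + 1 / (2 * Λ) := by field_simp; norm_num
      rw [e7] at e3
      have e8 : 0 ≤ 2 * Λ * K ^ 2 * f x ^ 2 := by positivity
      have e9 := neg_abs_le (2 * η x * v x * S)
      linarith
    · rw [indicator_of_notMem hx]
      have : η x = 0 := b.zero_of_le_dist (by simpa using hx)
      simp [this]
  have hgc := gn_sq_cont hv
  have hvc := hv.continuous
  have hffc := hfc.continuous
  have hηgi : Integrable fun x => η x ^ 2 * gn v x ^ 2 := by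
    refine Continuous.integrable_of_hasCompactSupport ((hηc.continuous.pow 2).mul hgc) ?_
    exact hcs_of_eq hηs fun x hx => by simp [image_eq_zero_of_notMem_tsupport hx]
  have hmain := integral_mono ((hηgi.const_mul (1 / (2 * Λ))).sub hJi)
    ((intOn_ball (F := fun x => (2 * Λ * K ^ 2 + 1) * (v x ^ 2 + f x ^ 2))
      (by fun_prop) r).integrable_indicator measurableSet_ball) hpt
  rw [integral_sub' (hηgi.const_mul (1 / (2 * Λ))) hJi, hJ, sub_zero, integral_const_mul,
    integral_indicator measurableSet_ball, integral_const_mul] at hmain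
  have hlow : ∫ x in closedBall (0 : Euc k) ρ, gn v x ^ 2 ≤ ∫ x, η x ^ 2 * gn v x ^ 2 := by
    rw [← integral_indicator measurableSet_closedBall]
    refine integral_mono ((intOn_cball hgc ρ).integrable_indicator measurableSet_closedBall)
      hηgi fun x => ?_
    by_cases hx : x ∈ closedBall (0 : Euc k) ρ
    · have : η x = 1 := b.one_of_mem_closedBall hx
      simp [hx, this]
    · rw [indicator_of_notMem hx]; positivity
  refine hlow.trans ?_
  rw [one_div, inv_mul_le_iff₀ (by positivity)] at hmain
  linarith

end cacc

section three
variable {k : ℕ}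

theorem Lop_mul {a : Fin k → Fin k → Euc k → ℝ} (ha : ∀ i j, ContDiff ℝ ∞ (a i j))
    {c v : Euc k → ℝ} (hc : ContDiff ℝ ∞ c) (hv : ContDiff ℝ ∞ v) (x : Euc k) :
    Lop a (fun y => c y * v y) x = c x * Lop a v x + (∑ i, pd i c x * flux a v i x)
      + (∑ i, pd i v x * flux a c i x) + v x * Lop a c x := by
  have e1 : ∀ i, flux a (fun y => c y * v y) i = fun y => c y * flux a v i y + v y * flux a c i y := by
    intro i; funext y
    simp only [flux, Finset.mul_sum, ← Finset.sum_add_distrib]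
    refine Finset.sum_congr rfl fun j _ => ?_
    rw [pd_mul (hc.dat y) (hv.dat y)]; ring
  simp only [Lop, Finset.mul_sum, ← Finset.sum_add_distrib]
  refine Finset.sum_congr rfl fun i _ => ?_
  have h1 := hc.dat x
  have h2 := hv.dat x
  have h3 := (flux_contDiff ha hv i).dat x
  have h4 := (flux_contDiff ha hc i).dat x
  rw [e1, pd_add (F := fun y => c y * flux a v i y) (G := fun y => v y * flux a c i y)
    (h1.mul h3) (h2.mul h4), pd_mul h1 h3, pd_mul h2 h4]
  ring

theorem Lop_bound {Λ L D : ℝ} (hΛ : 0 ≤ Λ) {a : Fin k → Fin k → Euc k → ℝ} (h : Ell Λ L a)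
    {c : Euc k → ℝ} (hc : ContDiff ℝ ∞ c) (h1 : ∀ i x, |pd i c x| ≤ D)
    (h2 : ∀ i j x, |pd i (pd j c) x| ≤ D) (x : Euc k) :
    |Lop a c x| ≤ k * (k * (L * D + Λ * D)) := by
  unfold Lop
  refine abs_sum_le' fun i => ?_
  rw [pd_flux h.smooth hc]
  exact abs_sum_le' fun j => abs_add_le' (abs_mul_le' (h.dbound i i j x) (h1 j x))
    (abs_mul_le' (h.bound i j x) (h2 i j x))

theorem cutoff_bound {Λ L D : ℝ} (hΛ : 0 ≤ Λ) (hL : 0 ≤ L) (hD : 0 ≤ D) :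
    ∃ M : ℝ, 0 ≤ M ∧ ∀ a : Fin k → Fin k → Euc k → ℝ, Ell Λ L a → ∀ c v : Euc k → ℝ,
      ContDiff ℝ ∞ c → ContDiff ℝ ∞ v → (∀ x, |c x| ≤ 1) → (∀ i x, |pd i c x| ≤ D) →
      (∀ i j x, |pd i (pd j c) x| ≤ D) → ∀ x,
      Lop a (fun y => c y * v y) x ^ 2 ≤
        3 * Lop a v x ^ 2 + 3 * M ^ 2 * (v x ^ 2 + gn v x ^ 2) := by
  refine ⟨k * (D * (k * Λ)) + k * (k * (Λ * D)) + k * (k * (L * D + Λ * D)), by positivity, ?_⟩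
  intro a h c v hc hv hc1 h1 h2 x
  rw [Lop_mul h.smooth hc hv]
  have b1 : |∑ i, pd i c x * flux a v i x| ≤ k * (D * (k * (Λ * gn v x))) :=
    abs_sum_le' fun i => abs_mul_le' (h1 i x) (flux_le h v i x)
  have b2 : |∑ i, pd i v x * flux a c i x| ≤ k * (gn v x * (k * (Λ * D))) :=
    abs_sum_le' fun i => abs_mul_le' (pd_le_gn v x i)
      (abs_sum_le' fun j => abs_mul_le' (h.bound i j x) (h1 j x))
  have b3 := Lop_bound hΛ h hc h1 h2 x
  have b4 : |c x * Lop a v x| ≤ 1 * |Lop a v x| := abs_mul_le' (hc1 x) le_rfl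
  have b5 : |v x * Lop a c x| ≤ |v x| * (k * (k * (L * D + Λ * D))) := abs_mul_le' le_rfl b3
  set M : ℝ := k * (D * (k * Λ)) + k * (k * (Λ * D)) + k * (k * (L * D + Λ * D)) with hM
  have hg := gn_nonneg v x
  set g := gn v x
  set f := Lop a v x
  set S1 := ∑ i, pd i c x * flux a v i x
  set S2 := ∑ i, pd i v x * flux a c i x
  have b6 : |c x * f + S1 + S2 + v x * Lop a c x| ≤ |f| + M * g + M * |v x| := by
    refine (abs_add_le' (abs_add_le' (abs_add_le' b4 b1) b2) b5).trans ?_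
    rw [hM]
    have t1 : 0 ≤ (k * (k * (L * D + Λ * D)) : ℝ) * g := by positivity
    have t2 : 0 ≤ (k * (D * (k * Λ)) + k * (k * (Λ * D)) : ℝ) * |v x| := by positivity
    linarith
  have b7 : (c x * f + S1 + S2 + v x * Lop a c x) ^ 2 ≤ (|f| + M * g + M * |v x|) ^ 2 := by
    rw [← sq_abs (c x * f + S1 + S2 + v x * Lop a c x)]
    gcongr
  refine b7.trans ?_
  rw [← sq_abs f, ← sq_abs (v x)]
  nlinarith [sq_nonneg (|f| - M * g), sq_nonneg (|f| - M * |v x|), sq_nonneg (M * g - M * |v x|)]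

theorem three_arith {M C1 C2 T1 T2 T3 d I1 I2 I3 F1 F3 V1 V3 G1 G3 : ℝ}
    (hC1 : 0 ≤ C1) (hC2 : 0 ≤ C2) (hF3 : 0 ≤ F3) (hI1 : 0 ≤ I1) (hI3 : 0 ≤ I3) (hT1p : 0 < T1)
    (hT2p : 0 < T2) (hT3p : 0 < T3) (hT12 : 1 ≤ T2) (hT31 : T3 ≤ T1) (hd : 0 < d)
    (hTd : d * T2 = T3) (hT21 : T2 ≤ T1 * T2)
    (hca1 : G1 ≤ C1 * (I1 + F1)) (hca2 : G3 ≤ C2 * (I3 + F3)) (m1 : V1 ≤ I1) (m2 : V3 ≤ I3)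
    (m3 : F1 ≤ F3)
    (hlow : T2 * I2 ≤ T2 * I1 + 2 * (T1 * (3 * M ^ 2) * (V1 + G1) + T3 * (3 * M ^ 2) * (V3 + G3)
      + T1 * 3 * F3)) :
    I2 ≤ (7 + 6 * M ^ 2 * (1 + C1) + 6 * M ^ 2 * (1 + C2)) * (T1 * (I1 + F3) + d * I3) := by
  have s1 : V1 + G1 ≤ (1 + C1) * (I1 + F3) := by
    have : C1 * (I1 + F1) ≤ C1 * (I1 + F3) := by gcongr
    linarith
  have s3 : V3 + G3 ≤ (1 + C2) * (I3 + F3) := by linarith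
  have s1' : T1 * (3 * M ^ 2) * (V1 + G1) ≤ T1 * (3 * M ^ 2) * ((1 + C1) * (I1 + F3)) := by gcongr
  have s3' : T3 * (3 * M ^ 2) * (V3 + G3) ≤ T3 * (3 * M ^ 2) * ((1 + C2) * (I3 + F3)) := by gcongr
  have s4 : T2 * I2 ≤ T2 * I1 + 2 * (T1 * (3 * M ^ 2) * ((1 + C1) * (I1 + F3)) +
      T3 * (3 * M ^ 2) * ((1 + C2) * (I3 + F3)) + T1 * 3 * F3) := by linarith
  have s5 : T2 * I1 ≤ T2 * (T1 * I1) := by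
    have := mul_le_mul_of_nonneg_right hT21 hI1
    linarith
  obtain ⟨P1, hP1e⟩ : ∃ P, P = 6 * M ^ 2 * (1 + C1) := ⟨_, rfl⟩
  obtain ⟨P2, hP2e⟩ : ∃ P, P = 6 * M ^ 2 * (1 + C2) := ⟨_, rfl⟩
  have hP1 : 0 ≤ P1 := by rw [hP1e]; positivity
  have hP2 : 0 ≤ P2 := by rw [hP2e]; positivity
  rw [← hP1e, ← hP2e]
  have s6 : T2 * I2 ≤ T2 * (T1 * I1) + P1 * (T1 * (I1 + F3)) + P2 * (T3 * I3) + P2 * (T1 * F3)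
      + 6 * (T1 * F3) := by
    have : P2 * (T3 * F3) ≤ P2 * (T1 * F3) := by gcongr
    have e1 : 2 * (T1 * (3 * M ^ 2) * ((1 + C1) * (I1 + F3))) = P1 * (T1 * (I1 + F3)) := by
      rw [hP1e]; ring
    have e2 : 2 * (T3 * (3 * M ^ 2) * ((1 + C2) * (I3 + F3))) = P2 * (T3 * I3) + P2 * (T3 * F3) := by
      rw [hP2e]; ring
    linarith
  clear s4 s3' s1' hlow hP1e hP2e
  have s7 : ∀ X : ℝ, 0 ≤ X → X ≤ T2 * X := fun X hX => le_mul_of_one_le_left hX hT12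
  have z1 := s7 (P1 * (T1 * (I1 + F3))) (by positivity)
  have z2 := s7 (P2 * (T1 * F3)) (by positivity)
  have z3 := s7 (6 * (T1 * F3)) (by positivity)
  have s8 : T2 * I2 ≤ T2 * (T1 * I1 + P1 * (T1 * (I1 + F3)) + P2 * (d * I3) + P2 * (T1 * F3)
      + 6 * (T1 * F3)) := by
    rw [← hTd] at s6
    linarith
  have s9 := le_of_mul_le_mul_left s8 hT2p
  refine s9.trans ?_
  have y1 : 0 ≤ T1 * I1 := by positivity
  have y2 : 0 ≤ T1 * F3 := by positivity
  have y3 : 0 ≤ d * I3 := by positivity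
  have y4 : 0 ≤ P1 * (d * I3) := by positivity
  have y5 : 0 ≤ P2 * (T1 * I1) := by positivity
  linarith

set_option maxHeartbeats 1600000 in
theorem three_smooth {Λ L r₁ r₂ r₃ : ℝ} (hΛ : 0 < Λ) (hL : 0 ≤ L) (h1 : 0 < r₁) (h12 : r₁ < r₂)
    (h23 : r₂ < r₃) :
    ∃ N > 0, ∃ δ > 0, ∃ τ₀ > 0, ∀ τ, τ₀ ≤ τ → ∀ a : Fin k → Fin k → Euc k → ℝ, Ell Λ L a →
      ∀ v : Euc k → ℝ, ContDiff ℝ ∞ v →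
      ∫ x in ball (0 : Euc k) r₂, v x ^ 2 ≤
        N * (Real.exp (2 * τ) * ((∫ x in ball (0 : Euc k) r₁, v x ^ 2) +
            ∫ x in ball (0 : Euc k) r₃, Lop a v x ^ 2) +
          Real.exp (-(2 * δ * τ)) * ∫ x in ball (0 : Euc k) r₃, v x ^ 2) := by
  obtain ⟨ρ₀, hρ0⟩ : ∃ ρ₀, ρ₀ = r₁ / 3 := ⟨_, rfl⟩
  obtain ⟨ρ₁, hρ1⟩ : ∃ ρ₁, ρ₁ = 2 * r₁ / 3 := ⟨_, rfl⟩
  obtain ⟨ρ₂, hρ2⟩ : ∃ ρ₂, ρ₂ = (2 * r₂ + r₃) / 3 := ⟨_, rfl⟩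
  obtain ⟨ρ₃, hρ3⟩ : ∃ ρ₃, ρ₃ = (r₂ + 2 * r₃) / 3 := ⟨_, rfl⟩
  have p0 : 0 < ρ₀ := by linarith
  have p01 : ρ₀ < ρ₁ := by linarith
  have p11 : ρ₁ < r₁ := by linarith
  have p22 : r₂ < ρ₂ := by linarith
  have p23 : ρ₂ < ρ₃ := by linarith
  have p33 : ρ₃ < r₃ := by linarith
  clear hρ0 hρ1 hρ2 hρ3
  let b1 : ContDiffBump (0 : Euc k) := ⟨ρ₀, ρ₁, p0, p01⟩
  let b2 : ContDiffBump (0 : Euc k) := ⟨ρ₂, ρ₃, by linarith, p23⟩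
  obtain ⟨c, hc⟩ : ∃ c : Euc k → ℝ, c = fun x => b2 x - b1 x := ⟨_, rfl⟩
  have hcc : ContDiff ℝ ∞ c := by rw [hc]; exact b2.contDiff.sub b1.contDiff
  have hcs : HasCompactSupport c := by
    rw [hc]; exact b2.hasCompactSupport.sub b1.hasCompactSupport
  have hc1 : ∀ x, |c x| ≤ 1 := by
    intro x; rw [hc, abs_le]
    have := b1.nonneg (x := x); have := b2.nonneg (x := x)
    have := b1.le_one (x := x); have := b2.le_one (x := x)
    constructor <;> simp only <;> linarith
  have hcA : ∀ x, ‖x‖ ≤ ρ₀ → c x = 0 := by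
    intro x hx
    simp only [hc]
    rw [b1.one_of_mem_closedBall (by simpa using hx),
      b2.one_of_mem_closedBall (by simp only [mem_closedBall_zero_iff]; exact hx.trans (by linarith)), sub_self]
  have hcB : ∀ x, ρ₃ ≤ ‖x‖ → c x = 0 := by
    intro x hx
    simp only [hc]
    rw [b1.zero_of_le_dist (by simp only [dist_zero_right]; exact le_trans (by linarith) hx),
      b2.zero_of_le_dist (by simpa using hx), sub_self]
  have hcM : ∀ x, ρ₁ ≤ ‖x‖ → ‖x‖ ≤ ρ₂ → c x = 1 := by
    intro x hx hx2
    simp only [hc]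
    rw [b1.zero_of_le_dist (by simpa using hx),
      b2.one_of_mem_closedBall (by simpa using hx2), sub_zero]
  obtain ⟨D1, hD10, hD1⟩ := bdd_fam (fun i => (pd_contDiff hcc i).continuous)
    (fun i => pd_hasCompactSupport hcs i)
  obtain ⟨D2, hD20, hD2⟩ := bdd_fam (F := fun p : Fin k × Fin k => pd p.1 (pd p.2 c))
    (fun p => (pd_contDiff (pd_contDiff hcc _) _).continuous)
    (fun p => pd_hasCompactSupport (pd_hasCompactSupport hcs _) _)
  obtain ⟨M, hM0, hM⟩ := cutoff_bound (k := k) (D := D1 + D2) hΛ.le hL (by positivity)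
  obtain ⟨lam, hlam, τ₁, hτ₁, hcar⟩ := carleman (k := k) (R := r₃) hΛ hL (by linarith) p0
  obtain ⟨C1, hC1, hca1⟩ := caccio (k := k) (L := L) hΛ (p0.trans p01) p11
  obtain ⟨C2, hC2, hca2⟩ := caccio (k := k) (L := L) hΛ (show 0 < ρ₃ by linarith) p33
  obtain ⟨f2, hf2⟩ : ∃ f2, f2 = Real.exp (-lam * r₂ ^ 2) := ⟨_, rfl⟩
  obtain ⟨f3, hf3⟩ : ∃ f3, f3 = Real.exp (-lam * ρ₂ ^ 2) := ⟨_, rfl⟩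
  have hff : f3 < f2 := by
    rw [hf2, hf3, Real.exp_lt_exp]
    have : r₂ ^ 2 < ρ₂ ^ 2 := by gcongr; linarith
    have := mul_lt_mul_of_pos_left this hlam; linarith
  have hf3p : 0 < f3 := by rw [hf3]; exact Real.exp_pos _
  have hf21 : f2 ≤ 1 := by
    rw [hf2, Real.exp_le_one_iff]; have := mul_nonneg hlam.le (sq_nonneg r₂); linarith
  refine ⟨7 + 6 * M ^ 2 * (1 + C1) + 6 * M ^ 2 * (1 + C2), by positivity, f2 - f3, by linarith,
    τ₁, hτ₁, fun τ hτ a h v hv => ?_⟩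
  have hτ0 : 0 < τ := by linarith
  obtain ⟨f, hf⟩ : ∃ f, f = Lop a v := ⟨_, rfl⟩
  have hfc : Continuous f := by rw [hf]; exact (Lop_contDiff h.smooth hv).continuous
  have hvc := hv.continuous
  have hgc := gn_sq_cont hv
  have hv2c : Continuous fun x => v x ^ 2 := by fun_prop
  have hf2c : Continuous fun x => f x ^ 2 := by fun_prop
  have hca1 := hca1 a h v hv
  have hca2 := hca2 a h v hv
  have hMx := hM a h c v hcc hv hc1 (fun i x => (hD1 i x).trans (by linarith))
    (fun i j x => (hD2 (i, j) x).trans (by linarith))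
  obtain ⟨u, hu⟩ : ∃ u : Euc k → ℝ, u = fun y => c y * v y := ⟨_, rfl⟩
  rw [← hf] at hca1 hca2 hMx ⊢
  rw [← hu] at hMx
  have huc : ContDiff ℝ ∞ u := by rw [hu]; exact hcc.mul hv
  have hus : HasCompactSupport u := by rw [hu]; exact hcs.mul_right
  have hts : ∀ x ∈ tsupport u, ρ₀ ≤ ‖x‖ ∧ ‖x‖ ≤ ρ₃ := by
    have hcl : IsClosed {x : Euc k | ρ₀ ≤ ‖x‖ ∧ ‖x‖ ≤ ρ₃} :=
      (isClosed_le continuous_const continuous_norm).inter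
        (isClosed_le continuous_norm continuous_const)
    refine fun x hx => closure_minimal ?_ hcl hx
    intro y hy
    by_contra hcon
    have : c y = 0 := by
      by_cases h0 : ‖y‖ ≤ ρ₀
      · exact hcA y h0
      · refine hcB y ?_
        by_contra h3
        exact hcon ⟨by linarith, by linarith⟩
    exact hy (by simp [hu, this])
  have hcar := hcar a h u huc hus (fun x hx => ⟨(hts x hx).1, (hts x hx).2.trans p33.le⟩) τ hτ
  have hmid : ∀ x, ρ₁ < ‖x‖ → ‖x‖ < ρ₂ → Lop a u x = f x := by
    intro x hx1 hx2
    have hev : ∀ᶠ y in 𝓝 x, u y = v y := by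
      have e1 : ∀ᶠ y in 𝓝 x, ρ₁ < ‖y‖ := continuous_norm.continuousAt.eventually_const_lt hx1
      have e2 : ∀ᶠ y in 𝓝 x, ‖y‖ < ρ₂ := continuous_norm.continuousAt.eventually_lt_const hx2
      filter_upwards [e1, e2] with y hy1 hy2
      rw [hu]; simp only; rw [hcM y hy1.le hy2.le, one_mul]
    rw [hf]
    unfold Lop
    refine Finset.sum_congr rfl fun i _ => pd_congr ?_ i
    filter_upwards [hev.eventually_nhds] with y hy
    unfold flux
    exact Finset.sum_congr rfl fun j _ => by rw [pd_congr hy j]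
  have hEsq : ∀ (x : Euc k) (t : ℝ), phi lam x ≤ t → Ew lam τ x ^ 2 ≤ Real.exp (2 * τ * t) := by
    intro x t ht
    unfold Ew
    rw [← Real.exp_nat_mul, Real.exp_le_exp]
    push_cast
    have := mul_le_mul_of_nonneg_left ht hτ0.le; linarith
  obtain ⟨T1, hT1⟩ : ∃ T, T = Real.exp (2 * τ) := ⟨_, rfl⟩
  obtain ⟨T3, hT3⟩ : ∃ T, T = Real.exp (2 * τ * f3) := ⟨_, rfl⟩
  obtain ⟨T2, hT2⟩ : ∃ T, T = Real.exp (2 * τ * f2) := ⟨_, rfl⟩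
  have hT1p : 0 < T1 := by rw [hT1]; exact Real.exp_pos _
  have hT2p : 0 < T2 := by rw [hT2]; exact Real.exp_pos _
  have hT3p : 0 < T3 := by rw [hT3]; exact Real.exp_pos _
  have hE1 : ∀ x : Euc k, Ew lam τ x ^ 2 ≤ T1 := by
    intro x
    have := hEsq x 1 (phi_le_one hlam.le x)
    rwa [mul_one, ← hT1] at this
  have hpt : ∀ x, (Ew lam τ x * Lop a u x) ^ 2 ≤
      (closedBall (0 : Euc k) ρ₁).indicator (fun x => T1 * (3 * M ^ 2) * (v x ^ 2 + gn v x ^ 2)) x +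
      (closedBall (0 : Euc k) ρ₃).indicator (fun x => T3 * (3 * M ^ 2) * (v x ^ 2 + gn v x ^ 2)) x +
      (ball (0 : Euc k) r₃).indicator (fun x => T1 * 3 * f x ^ 2) x := by
    intro x
    have n1 : 0 ≤ (closedBall (0 : Euc k) ρ₁).indicator
      (fun x => T1 * (3 * M ^ 2) * (v x ^ 2 + gn v x ^ 2)) x :=
      indicator_nonneg (fun x _ => by positivity) x
    have n2 : 0 ≤ (closedBall (0 : Euc k) ρ₃).indicator
      (fun x => T3 * (3 * M ^ 2) * (v x ^ 2 + gn v x ^ 2)) x :=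
      indicator_nonneg (fun x _ => by positivity) x
    have n3 : 0 ≤ (ball (0 : Euc k) r₃).indicator (fun x => T1 * 3 * f x ^ 2) x :=
      indicator_nonneg (fun x _ => by positivity) x
    have hE := hE1 x
    have hMM := hMx x
    rw [mul_pow]
    have hfn : 0 ≤ f x ^ 2 := sq_nonneg _
    have hvn : 0 ≤ 3 * M ^ 2 * (v x ^ 2 + gn v x ^ 2) := by positivity
    by_cases hx3 : ‖x‖ ≤ ρ₃
    · have hx3b : x ∈ ball (0 : Euc k) r₃ := by
        rw [mem_ball_zero_iff]; linarith
      rw [indicator_of_mem hx3b] at n3 ⊢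
      by_cases hx1 : ‖x‖ ≤ ρ₁
      · rw [indicator_of_mem (show x ∈ closedBall (0 : Euc k) ρ₁ by simpa using hx1)] at n1 ⊢
        calc _ ≤ T1 * (3 * f x ^ 2 + 3 * M ^ 2 * (v x ^ 2 + gn v x ^ 2)) := by gcongr
          _ ≤ _ := by linarith
      · by_cases hx2 : ρ₂ ≤ ‖x‖
        · have hp : phi lam x ≤ f3 := by
            rw [phi_eq, hf3, Real.exp_le_exp]
            have : ρ₂ ^ 2 ≤ ‖x‖ ^ 2 := by gcongr; linarith
            have := mul_le_mul_of_nonneg_left this hlam.le; linarith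
          have hE3 := hEsq x f3 hp
          rw [← hT3] at hE3
          rw [indicator_of_mem (show x ∈ closedBall (0 : Euc k) ρ₃ by simpa using hx3)] at n2 ⊢
          have q1 : Ew lam τ x ^ 2 * Lop a u x ^ 2 ≤
              Ew lam τ x ^ 2 * (3 * f x ^ 2) +
              Ew lam τ x ^ 2 * (3 * M ^ 2 * (v x ^ 2 + gn v x ^ 2)) := by
            rw [← mul_add]; gcongr
          have q2 : Ew lam τ x ^ 2 * (3 * f x ^ 2) ≤ T1 * (3 * f x ^ 2) := by gcongr
          have q3 : Ew lam τ x ^ 2 * (3 * M ^ 2 * (v x ^ 2 + gn v x ^ 2)) ≤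
            T3 * (3 * M ^ 2 * (v x ^ 2 + gn v x ^ 2)) := by gcongr
          linarith
        · rw [hmid x (by linarith) (by linarith)]
          have q2 : Ew lam τ x ^ 2 * (f x ^ 2) ≤ T1 * (f x ^ 2) := by gcongr
          have : 0 ≤ T1 * (f x ^ 2) := by positivity
          linarith
    · have : x ∉ tsupport u := fun hx => hx3 (hts x hx).2
      rw [Lop_zero_of this]
      simp only [ne_eq, OfNat.ofNat_ne_zero, not_false_eq_true, zero_pow, mul_zero]
      linarith
  have hvg : Continuous fun x => v x ^ 2 + gn v x ^ 2 := hv2c.add hgc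
  have i1 : Integrable ((closedBall (0 : Euc k) ρ₁).indicator
      (fun x => T1 * (3 * M ^ 2) * (v x ^ 2 + gn v x ^ 2))) :=
    (intOn_cball (hvg.const_mul _) _).integrable_indicator measurableSet_closedBall
  have i2 : Integrable ((closedBall (0 : Euc k) ρ₃).indicator
      (fun x => T3 * (3 * M ^ 2) * (v x ^ 2 + gn v x ^ 2))) :=
    (intOn_cball (hvg.const_mul _) _).integrable_indicator measurableSet_closedBall
  have i3 : Integrable ((ball (0 : Euc k) r₃).indicator (fun x => T1 * 3 * f x ^ 2)) :=
    (intOn_ball (hf2c.const_mul _) _).integrable_indicator measurableSet_ball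
  have hLc := (Lop_contDiff h.smooth huc).continuous
  have hEc := (Ew_contDiff (k := k) lam τ).continuous
  have j2 : Integrable (fun x => (Ew lam τ x * Lop a u x) ^ 2) := by
    refine Continuous.integrable_of_hasCompactSupport (by fun_prop)
      (hcs_of_eq hus fun x hx => ?_)
    simp [Lop_zero_of hx]
  have j1 : Integrable (fun x => (Ew lam τ x * u x) ^ 2) := by
    have := huc.continuous
    refine Continuous.integrable_of_hasCompactSupport (by fun_prop)
      (hcs_of_eq hus fun x hx => ?_)
    simp [image_eq_zero_of_notMem_tsupport hx]
  have hup := integral_mono j2 ((i1.add i2).add i3) hpt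
  rw [integral_add' (i1.add i2) i3, integral_add' i1 i2, integral_indicator measurableSet_closedBall,
    integral_indicator measurableSet_closedBall, integral_indicator measurableSet_ball,
    integral_const_mul, integral_const_mul, integral_const_mul,
    integral_add (intOn_cball hv2c _) (intOn_cball hgc _),
    integral_add (intOn_cball hv2c _) (intOn_cball hgc _)] at hup
  rw [integral_add (intOn_ball hv2c _) (intOn_ball hf2c _)] at hca1 hca2
  have m1 : ∫ x in closedBall (0 : Euc k) ρ₁, v x ^ 2 ≤ ∫ x in ball (0 : Euc k) r₁, v x ^ 2 :=
    setIntegral_mono_set (intOn_ball hv2c _) (Filter.Eventually.of_forall fun x => sq_nonneg _)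
      (closedBall_subset_ball p11).eventuallyLE
  have m2 : ∫ x in closedBall (0 : Euc k) ρ₃, v x ^ 2 ≤ ∫ x in ball (0 : Euc k) r₃, v x ^ 2 :=
    setIntegral_mono_set (intOn_ball hv2c _) (Filter.Eventually.of_forall fun x => sq_nonneg _)
      (closedBall_subset_ball p33).eventuallyLE
  have m3 : ∫ x in ball (0 : Euc k) r₁, f x ^ 2 ≤ ∫ x in ball (0 : Euc k) r₃, f x ^ 2 :=
    setIntegral_mono_set (intOn_ball hf2c _) (Filter.Eventually.of_forall fun x => sq_nonneg _)
      (ball_subset_ball (by linarith)).eventuallyLE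
  have hlow : T2 * (∫ x in ball (0 : Euc k) r₂, v x ^ 2) ≤
      T2 * (∫ x in ball (0 : Euc k) r₁, v x ^ 2) + ∫ x, (Ew lam τ x * u x) ^ 2 := by
    rw [← integral_const_mul, ← integral_const_mul, ← integral_indicator measurableSet_ball,
      ← integral_indicator measurableSet_ball, ← integral_add _ j1]
    · refine integral_mono ((intOn_ball (hv2c.const_mul _) _).integrable_indicator
        measurableSet_ball) (((intOn_ball (hv2c.const_mul _) _).integrable_indicator
        measurableSet_ball).add j1) fun x => ?_
      simp only
      have nn : 0 ≤ (ball (0 : Euc k) r₁).indicator (fun x => T2 * v x ^ 2) x :=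
        indicator_nonneg (fun x _ => by positivity) x
      by_cases hx2 : ‖x‖ < r₂
      · rw [indicator_of_mem (show x ∈ ball (0 : Euc k) r₂ by simpa using hx2)]
        by_cases hx1 : ‖x‖ < r₁
        · rw [indicator_of_mem (show x ∈ ball (0 : Euc k) r₁ by simpa using hx1)]
          have := sq_nonneg (Ew lam τ x * u x)
          linarith
        · have hux : u x = v x := by
            rw [hu]; simp only; rw [hcM x (by linarith) (by linarith), one_mul]
          have hE : T2 ≤ Ew lam τ x ^ 2 := by
            unfold Ew
            rw [hT2, ← Real.exp_nat_mul, Real.exp_le_exp]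
            have : f2 ≤ phi lam x := by
              rw [phi_eq, hf2, Real.exp_le_exp]
              have : ‖x‖ ^ 2 ≤ r₂ ^ 2 := by gcongr
              have := mul_le_mul_of_nonneg_left this hlam.le; linarith
            push_cast
            have := mul_le_mul_of_nonneg_left this hτ0.le; linarith
          have : T2 * v x ^ 2 ≤ Ew lam τ x ^ 2 * v x ^ 2 := by gcongr
          rw [hux, mul_pow]
          linarith
      · rw [indicator_of_notMem (show x ∉ ball (0 : Euc k) r₂ by simpa using hx2)]
        positivity
    · exact (intOn_ball (hv2c.const_mul _) _).integrable_indicator measurableSet_ball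
  have hF3 : 0 ≤ ∫ x in ball (0 : Euc k) r₃, f x ^ 2 := integral_nonneg fun x => sq_nonneg _
  have hI1 : 0 ≤ ∫ x in ball (0 : Euc k) r₁, v x ^ 2 := integral_nonneg fun x => sq_nonneg _
  have hI3 : 0 ≤ ∫ x in ball (0 : Euc k) r₃, v x ^ 2 := integral_nonneg fun x => sq_nonneg _
  have hT12 : 1 ≤ T2 := by
    rw [hT2, Real.one_le_exp_iff]; have : 0 < f2 := by linarith
    positivity
  have hT31 : T3 ≤ T1 := by
    rw [hT1, hT3, Real.exp_le_exp]; have := mul_le_mul_of_nonneg_left (hff.le.trans hf21) hτ0.le; linarith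
  have hT21 : T2 ≤ T1 * T2 := by
    have : 1 ≤ T1 := by rw [hT1, Real.one_le_exp_iff]; positivity
    exact le_mul_of_one_le_left hT2p.le this
  have hTd : Real.exp (-(2 * (f2 - f3) * τ)) * T2 = T3 := by
    rw [hT2, hT3, ← Real.exp_add]; congr 1; ring
  rw [← hT1]
  exact three_arith hC1.le hC2.le hF3 hI1 hI3 hT1p hT2p hT3p hT12 hT31 (Real.exp_pos _) hTd
    hT21 hca1 hca2 m1 m2 m3 (hlow.trans (add_le_add le_rfl (hcar.trans
      (mul_le_mul_of_nonneg_left hup zero_le_two))))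

end three

section moll
variable {k : ℕ}

def cv (f g : Euc k → ℝ) (x : Euc k) : ℝ := ∫ t, f t * g (x - t)

theorem cv_eq (f g : Euc k → ℝ) : cv f g = convolution f g (ContinuousLinearMap.mul ℝ ℝ) volume := by
  funext x; simp [cv, convolution]

theorem cv_comm (f g : Euc k → ℝ) : cv f g = cv g f := by
  funext x
  unfold cv
  rw [← integral_sub_left_eq_self (fun t => f t * g (x - t)) volume x]
  refine integral_congr_ae (Filter.Eventually.of_forall fun t => ?_)
  simp [mul_comm]

theorem cv_contDiff {f g : Euc k → ℝ} (hf : Continuous f) (hg : ContDiff ℝ ∞ g)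
    (hc : HasCompactSupport g) : ContDiff ℝ ∞ (cv f g) := by
  rw [cv_eq]
  exact hc.contDiff_convolution_right _ hf.locallyIntegrable hg

theorem pd_cv {f g : Euc k → ℝ} (hf : Continuous f) (hg : ContDiff ℝ 1 g)
    (hc : HasCompactSupport g) (i : Fin k) : pd i (cv f g) = cv f (pd i g) := by
  funext x
  rw [cv_eq, cv_eq]
  unfold pd
  rw [(hc.hasFDerivAt_convolution_right _ hf.locallyIntegrable hg x).fderiv,
    convolution_precompR_apply _ hf.locallyIntegrable (hc.fderiv ℝ)
      (hg.continuous_fderiv one_ne_zero)]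

theorem cv_integrable {f g : Euc k → ℝ} (hf : Continuous f) (hg : Continuous g)
    (hc : HasCompactSupport g) (x : Euc k) : Integrable fun t => f t * g (x - t) := by
  have := hc.convolutionExists_right (ContinuousLinearMap.mul ℝ ℝ) hf.locallyIntegrable hg x
    (μ := volume)
  simpa [ConvolutionExistsAt] using this

theorem cv_bound {f g : Euc k → ℝ} (hf : Continuous f) (hg : Continuous g)
    (hc : HasCompactSupport g) {ε B : ℝ} (hz : ∀ y, ε ≤ ‖y‖ → g y = 0) {x : Euc k}
    (hB : ∀ t, ‖x - t‖ < ε → |f t| ≤ B) : |cv f g x| ≤ B * ∫ y, |g y| := by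
  unfold cv
  have hgi : Integrable fun y => |g y| := (hg.integrable_of_hasCompactSupport hc).abs
  have h1 : Integrable fun t => |g (x - t)| := hgi.comp_sub_left x
  rw [← integral_sub_left_eq_self (fun t => |g t|) volume x, ← integral_const_mul]
  refine (abs_integral_le_integral_abs).trans ?_
  refine integral_mono (cv_integrable hf hg hc x).abs (h1.const_mul _) fun t => ?_
  simp only [abs_mul]
  by_cases ht : ‖x - t‖ < ε
  · gcongr; exact hB t ht
  · simp [hz _ (not_lt.1 ht)]

theorem cv_one (g : Euc k → ℝ) (c : ℝ) (x : Euc k) : cv (fun _ => c) g x = c * ∫ y, g y := by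
  unfold cv
  rw [integral_const_mul, integral_sub_left_eq_self g volume x]

theorem cv_add {f f' g : Euc k → ℝ} (hf : Continuous f) (hf' : Continuous f') (hg : Continuous g)
    (hc : HasCompactSupport g) (x : Euc k) :
    cv (fun t => f t + f' t) g x = cv f g x + cv f' g x := by
  unfold cv
  rw [← integral_add (cv_integrable hf hg hc x) (cv_integrable hf' hg hc x)]
  simp only [add_mul]

theorem cv_cmul (c : ℝ) (f g : Euc k → ℝ) (x : Euc k) :
    cv (fun t => c * f t) g x = c * cv f g x := by
  unfold cv
  rw [← integral_const_mul]
  simp only [mul_assoc]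

theorem kernel_exists (k : ℕ) : ∃ C : ℝ, 0 ≤ C ∧ ∀ ε : ℝ, 0 < ε → ∃ ρ : Euc k → ℝ, ContDiff ℝ ∞ ρ ∧
    HasCompactSupport ρ ∧ (∀ y, 0 ≤ ρ y) ∧ (∀ y, ε ≤ ‖y‖ → ρ y = 0) ∧ (∫ y, ρ y = 1) ∧
    (∀ i y, ε ≤ ‖y‖ → pd i ρ y = 0) ∧ ∀ i, ∫ y, |pd i ρ y| ≤ C / ε := by
  let b : ContDiffBump (0 : Euc k) := ⟨1 / 4, 1 / 2, by norm_num, by norm_num⟩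
  obtain ⟨ρ, hρ⟩ : ∃ ρ : Euc k → ℝ, ρ = b.normed volume := ⟨_, rfl⟩
  have h1 : ContDiff ℝ ∞ ρ := by rw [hρ]; exact b.contDiff_normed
  have h2 : HasCompactSupport ρ := by rw [hρ]; exact b.hasCompactSupport_normed
  have h3 : ∀ y, 0 ≤ ρ y := by rw [hρ]; exact b.nonneg_normed
  have h4 : ∫ y, ρ y = 1 := by rw [hρ]; exact b.integral_normed
  have h5 : tsupport ρ = closedBall 0 (1 / 2) := by rw [hρ]; exact b.tsupport_normed_eq
  have hn : ∀ i, 0 ≤ ∫ y, |pd i ρ y| := fun i => integral_nonneg fun y => abs_nonneg _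
  refine ⟨∑ i, ∫ y, |pd i ρ y|, Finset.sum_nonneg fun i _ => hn i, fun ε hε => ?_⟩
  have hs : ∀ y : Euc k, ε ≤ ‖y‖ → ε⁻¹ • y ∉ tsupport ρ := by
    intro y hy
    rw [h5, mem_closedBall_zero_iff, norm_smul, norm_inv, Real.norm_of_nonneg hε.le, not_le]
    have : 1 ≤ ε⁻¹ * ‖y‖ := by rw [inv_mul_eq_div, le_div_iff₀ hε]; linarith
    linarith
  have hpd : ∀ i (y : Euc k), pd i (fun y => (ε⁻¹) ^ k * ρ (ε⁻¹ • y)) y =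
      (ε⁻¹) ^ k * (ε⁻¹ * pd i ρ (ε⁻¹ • y)) := by
    intro i y
    have hd : DifferentiableAt ℝ (fun y => ρ (ε⁻¹ • y)) y :=
      (h1.comp (contDiff_const_smul _)).dat y
    rw [pd_const_mul _ hd]
    unfold pd
    have : fderiv ℝ (fun y => ρ (ε⁻¹ • y)) y = ε⁻¹ • fderiv ℝ ρ (ε⁻¹ • y) := fderiv_comp_smul _
    rw [this]
    simp
  have hrk : Module.finrank ℝ (Euc k) = k := by simp
  refine ⟨fun y => (ε⁻¹) ^ k * ρ (ε⁻¹ • y), ?_, ?_, fun y => ?_, fun y hy => ?_, ?_, ?_, ?_⟩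
  · exact contDiff_const.mul (h1.comp (contDiff_const_smul _))
  · exact (h2.comp_smul (inv_ne_zero hε.ne')).mul_left
  · have := h3 (ε⁻¹ • y); positivity
  · simp [image_eq_zero_of_notMem_tsupport (hs y hy)]
  · rw [integral_const_mul, Measure.integral_comp_smul_of_nonneg volume ρ ε⁻¹ (hR := by positivity), h4, hrk]
    simp only [smul_eq_mul, mul_one]
    exact mul_inv_cancel₀ (by positivity)
  · intro i y hy
    rw [hpd, pd_zero_of (hs y hy)]; simp
  · intro i
    simp only [hpd, abs_mul]
    rw [integral_const_mul, integral_const_mul,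
      Measure.integral_comp_smul_of_nonneg volume (fun y => |pd i ρ y|) ε⁻¹ (hR := by positivity), hrk,
      abs_of_nonneg (by positivity), abs_of_nonneg (by positivity)]
    have : ∫ y, |pd i ρ y| ≤ ∑ i, ∫ y, |pd i ρ y| :=
      Finset.single_le_sum (f := fun i => ∫ y, |pd i ρ y|) (fun i _ => hn i) (Finset.mem_univ i)
    have e : ε⁻¹ ^ k * (ε⁻¹ * ((ε⁻¹ ^ k)⁻¹ • ∫ y, |pd i ρ y|)) = (∫ y, |pd i ρ y|) / ε := by
      rw [smul_eq_mul]; field_simp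
    rw [e]
    gcongr

end moll

section approx
variable {k : ℕ}

structure Ker (C ε : ℝ) (ρ : Euc k → ℝ) : Prop where
  smooth : ContDiff ℝ ∞ ρ
  cs : HasCompactSupport ρ
  nonneg : ∀ y, 0 ≤ ρ y
  zero : ∀ y, ε ≤ ‖y‖ → ρ y = 0
  int : ∫ y, ρ y = 1
  dzero : ∀ i y, ε ≤ ‖y‖ → pd i ρ y = 0
  dint : ∀ i, ∫ y, |pd i ρ y| ≤ C / ε

theorem Ker.abs_int {C ε : ℝ} {ρ : Euc k → ℝ} (h : Ker C ε ρ) : ∫ y, |ρ y| = 1 := by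
  rw [← h.int]
  exact integral_congr_ae (Filter.Eventually.of_forall fun y => abs_of_nonneg (h.nonneg y))

theorem Ker.S_bound {C ε B : ℝ} {ρ f : Euc k → ℝ} (h : Ker C ε ρ) (hf : Continuous f) {x : Euc k}
    (hB : ∀ t, ‖x - t‖ < ε → |f t| ≤ B) : |cv f ρ x| ≤ B := by
  have := cv_bound hf h.smooth.continuous h.cs h.zero hB
  rwa [h.abs_int, mul_one] at this

theorem Ker.D_bound {C ε B : ℝ} {ρ f : Euc k → ℝ} (h : Ker C ε ρ) (hf : Continuous f) {x : Euc k}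
    (hB0 : 0 ≤ B) (hB : ∀ t, ‖x - t‖ < ε → |f t| ≤ B) (i : Fin k) :
    |cv f (pd i ρ) x| ≤ B * (C / ε) := by
  refine (cv_bound hf (pd_contDiff h.smooth i).continuous (pd_hasCompactSupport h.cs i)
    (h.dzero i) hB).trans ?_
  have := h.dint i
  gcongr

theorem Ker.S_shift {C ε : ℝ} {ρ f : Euc k → ℝ} (h : Ker C ε ρ) (hf : Continuous f) (c : ℝ)
    (x : Euc k) : cv f ρ x = cv (fun t => f t - c) ρ x + c := by
  have := cv_add (f := fun t => f t - c) (f' := fun _ => c) (by fun_prop) (by fun_prop)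
    h.smooth.continuous h.cs x
  rw [cv_one, h.int, mul_one] at this
  rw [← this]; simp

theorem Ker.D_shift {C ε : ℝ} {ρ f : Euc k → ℝ} (h : Ker C ε ρ) (hf : Continuous f) (c : ℝ)
    (i : Fin k) (x : Euc k) : cv f (pd i ρ) x = cv (fun t => f t - c) (pd i ρ) x := by
  have := cv_add (f := fun t => f t - c) (f' := fun _ => c) (by fun_prop) (by fun_prop)
    (pd_contDiff h.smooth i).continuous (pd_hasCompactSupport h.cs i) x
  rw [cv_one, integral_pd h.smooth h.cs, mul_zero, add_zero] at this
  rw [← this]; simp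

theorem Ker.comm {C ε ℓ w₀ : ℝ} {ρ α g : Euc k → ℝ} (h : Ker C ε ρ) (hε : 0 < ε) (hC : 0 ≤ C)
    (hℓ : 0 ≤ ℓ) (hw₀ : 0 ≤ w₀)
    (hα : Continuous α) (hg : Continuous g) {x : Euc k}
    (h1 : ∀ t, ‖x - t‖ < ε → |α t - α x| ≤ ℓ * ε) (h2 : ∀ t, ‖x - t‖ < ε → |g t - g x| ≤ w₀)
    (i : Fin k) :
    |cv α (pd i ρ) x * cv g ρ x + cv α ρ x * cv g (pd i ρ) x - cv (fun t => α t * g t) (pd i ρ) x|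
      ≤ 3 * (ℓ * C * w₀) := by
  have hα0 : Continuous fun t => α t - α x := by fun_prop
  have hg0 : Continuous fun t => g t - g x := by fun_prop
  have hαg : Continuous fun t => (α t - α x) * (g t - g x) := by fun_prop
  have hpc := (pd_contDiff h.smooth i).continuous
  have hps := pd_hasCompactSupport h.cs i
  have e3 : cv (fun t => α t * g t) (pd i ρ) x = cv (fun t => (α t - α x) * (g t - g x)) (pd i ρ) x
      + α x * cv (fun t => g t - g x) (pd i ρ) x + g x * cv (fun t => α t - α x) (pd i ρ) x := by
    rw [h.D_shift (f := fun t => α t * g t) (by fun_prop) (α x * g x) i x, ← cv_cmul, ← cv_cmul,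
      ← cv_add hαg (by fun_prop) hpc hps, ← cv_add (by fun_prop) (by fun_prop) hpc hps]
    congr 1; funext t; ring
  rw [e3, h.S_shift hα (α x), h.S_shift hg (g x), h.D_shift hα (α x), h.D_shift hg (g x)]
  have b1 := h.D_bound hα0 (by positivity) h1 i
  have b2 := h.S_bound hg0 h2
  have b3 := h.S_bound hα0 h1
  have b4 := h.D_bound hg0 hw₀ h2 i
  have b5 := h.D_bound (x := x) (B := ℓ * ε * w₀) hαg (by positivity)
    (fun t ht => abs_mul_le' (h1 t ht) (h2 t ht)) i
  have c1 := abs_mul_le' b1 b2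
  have c2 := abs_mul_le' b3 b4
  have e : ∀ a b c d e u v : ℝ, a * (b + u) + (c + v) * d - (e + v * d + u * a) = a * b + c * d + -e := by
    intros; ring
  rw [e]
  rw [← abs_neg] at b5
  refine (abs_add_le' (abs_add_le' c1 c2) b5).trans (le_of_eq ?_)
  field_simp
  ring

def rad (r : ℝ) (x : Euc k) : Euc k := (r / max r ‖x‖) • x

theorem rad_id {r : ℝ} (hr : 0 < r) {x : Euc k} (hx : ‖x‖ ≤ r) : rad r x = x := by
  unfold rad
  rw [max_eq_left hx, div_self hr.ne', one_smul]

theorem rad_norm {r : ℝ} (hr : 0 < r) (x : Euc k) : ‖rad r x‖ ≤ r := by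
  unfold rad
  have h1 : 0 < max r ‖x‖ := lt_max_of_lt_left hr
  rw [norm_smul, Real.norm_of_nonneg (by positivity), div_mul_eq_mul_div, div_le_iff₀ h1]
  gcongr
  exact le_max_right _ _

theorem rad_lip {r : ℝ} (hr : 0 < r) (x y : Euc k) : ‖rad r x - rad r y‖ ≤ 2 * ‖x - y‖ := by
  unfold rad
  have hx : 0 < max r ‖x‖ := lt_max_of_lt_left hr
  have hy : 0 < max r ‖y‖ := lt_max_of_lt_left hr
  have h1 : ‖x‖ ≤ max r ‖x‖ := le_max_right _ _
  have h2 : r ≤ max r ‖y‖ := le_max_left _ _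
  have h3 : |max r ‖y‖ - max r ‖x‖| ≤ ‖x - y‖ := by
    rw [max_comm r, max_comm r]
    refine (abs_max_sub_max_le_abs _ _ _).trans ?_
    rw [norm_sub_rev]
    exact abs_norm_sub_norm_le y x
  set p := max r ‖x‖
  set q := max r ‖y‖
  have e : (r / p) • x - (r / q) • y = ((r / p) - (r / q)) • x + (r / q) • (x - y) := by
    rw [sub_smul, smul_sub]; abel
  rw [e]
  refine (norm_add_le _ _).trans ?_
  have e1 : ‖(r / p - r / q) • x‖ ≤ ‖x - y‖ := by
    rw [norm_smul, Real.norm_eq_abs]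
    have : r / p - r / q = (r / q) * (q - p) / p := by field_simp
    rw [this, abs_div, abs_mul, abs_of_pos hx, abs_of_nonneg (by positivity)]
    have h5 : r / q ≤ 1 := (div_le_one hy).2 h2
    have h6 : r / q * |q - p| ≤ 1 * ‖x - y‖ := by gcongr
    rw [div_mul_eq_mul_div, div_le_iff₀ hx]
    calc _ ≤ (1 * ‖x - y‖) * p := by gcongr
      _ = _ := by ring
  have e2 : ‖(r / q) • (x - y)‖ ≤ ‖x - y‖ := by
    rw [norm_smul, Real.norm_of_nonneg (by positivity)]
    exact mul_le_of_le_one_left (norm_nonneg _) ((div_le_one hy).2 h2)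
  linarith

theorem entry_bound {Λ : ℝ} (hΛ : 1 ≤ Λ) {B : Matrix (Fin k) (Fin k) ℝ} (hs : B.IsSymm)
    (he : ∀ ξ : Fin k → ℝ,
      Λ⁻¹ * (∑ i, ξ i ^ 2) ≤ aForm B ξ ξ ∧ aForm B ξ ξ ≤ Λ * (∑ i, ξ i ^ 2)) (i j : Fin k) :
    |B i j| ≤ Λ := by
  have key : ∀ s : ℝ, aForm B (fun m => (if m = i then 1 else 0) + s * (if m = j then 1 else 0))
      (fun m => (if m = i then 1 else 0) + s * (if m = j then 1 else 0)) =
      B i i + s * (B i j + B j i) + s ^ 2 * B j j := by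
    intro s
    simp [aForm, mul_add, add_mul, Finset.sum_add_distrib]
    ring
  have nrm : ∀ s : ℝ, s ^ 2 = 1 → ∑ m, ((if m = i then (1:ℝ) else 0) + s * (if m = j then 1 else 0)) ^ 2 ≤ 4 := by
    intro s hs
    have : ∀ m, ((if m = i then (1:ℝ) else 0) + s * (if m = j then 1 else 0)) ^ 2 ≤
        2 * (if m = i then (1:ℝ) else 0) + 2 * (if m = j then 1 else 0) := by
      intro m
      split_ifs <;> nlinarith [sq_nonneg (1 - s)]
    refine (Finset.sum_le_sum fun m _ => this m).trans ?_
    simp [Finset.sum_add_distrib]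
    norm_num
  have hp := he (fun m => (if m = i then 1 else 0) + 1 * (if m = j then 1 else 0))
  have hm := he (fun m => (if m = i then 1 else 0) + (-1) * (if m = j then 1 else 0))
  have np := nrm 1 (by norm_num)
  have nm := nrm (-1) (by norm_num)
  rw [key] at hp hm
  have hij : B j i = B i j := hs.apply i j
  rw [hij] at hp hm
  have zp : 0 ≤ Λ⁻¹ * ∑ m, ((if m = i then (1:ℝ) else 0) + 1 * (if m = j then 1 else 0)) ^ 2 := by
    positivity
  have zm : 0 ≤ Λ⁻¹ * ∑ m, ((if m = i then (1:ℝ) else 0) + (-1) * (if m = j then 1 else 0)) ^ 2 :=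
    mul_nonneg (by positivity) (Finset.sum_nonneg fun m _ => sq_nonneg _)
  have up := mul_le_mul_of_nonneg_left np (show 0 ≤ Λ by linarith)
  have um := mul_le_mul_of_nonneg_left nm (show 0 ≤ Λ by linarith)
  rw [abs_le]
  constructor <;> linarith [hp.1, hp.2, hm.1, hm.2]

end approx

section approx2
variable {k : ℕ}

theorem ell_mollify {C ε ℓ Λ : ℝ} {ρ : Euc k → ℝ} (h : Ker C ε ρ) (hε : 0 < ε)
    (hℓ : 0 ≤ ℓ) {α : Fin k → Fin k → Euc k → ℝ} (hc : ∀ i j, Continuous (α i j))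
    (hl : ∀ i j t x, |α i j t - α i j x| ≤ ℓ * ‖x - t‖)
    (hs : ∀ i j t, α i j t = α j i t)
    (hlow : ∀ t, ∀ ξ : Fin k → ℝ, Λ⁻¹ * (∑ i, ξ i ^ 2) ≤ ∑ i, ∑ j, α i j t * ξ j * ξ i)
    (hb : ∀ i j t, |α i j t| ≤ Λ) : Ell Λ (ℓ * C) (fun i j => cv (α i j) ρ) := by
  refine ⟨fun i j => cv_contDiff (hc i j) h.smooth h.cs, ?_, ?_, ?_, ?_⟩
  · intro i j
    have : α i j = α j i := funext (hs i j)
    simp only [this]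
  · intro x ξ
    have e1 : Λ⁻¹ * (∑ i, ξ i ^ 2) = ∫ t, (Λ⁻¹ * (∑ i, ξ i ^ 2)) * ρ (x - t) := by
      have := cv_one ρ (Λ⁻¹ * (∑ i, ξ i ^ 2)) x
      rw [h.int, mul_one] at this
      exact this.symm
    have hI : ∀ i j, Integrable fun t => α i j t * ρ (x - t) * ξ j * ξ i := fun i j =>
      ((cv_integrable (hc i j) h.smooth.continuous h.cs x).mul_const _).mul_const _
    have e2 : ∑ i, ∑ j, cv (α i j) ρ x * ξ j * ξ i =
        ∫ t, ∑ i, ∑ j, α i j t * ρ (x - t) * ξ j * ξ i := by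
      rw [integral_finsetSum _ fun i _ => integrable_finsetSum _ fun j _ => hI i j]
      refine Finset.sum_congr rfl fun i _ => ?_
      rw [integral_finsetSum _ fun j _ => hI i j]
      refine Finset.sum_congr rfl fun j _ => ?_
      rw [integral_mul_const, integral_mul_const]
      rfl
    rw [e1, e2]
    refine integral_mono (cv_integrable (f := fun _ => Λ⁻¹ * (∑ i, ξ i ^ 2)) continuous_const
      h.smooth.continuous h.cs x)
      (integrable_finsetSum _ fun i _ => integrable_finsetSum _ fun j _ => hI i j) fun t => ?_
    have := mul_le_mul_of_nonneg_right (hlow t ξ) (h.nonneg (x - t))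
    refine this.trans (le_of_eq ?_)
    rw [Finset.sum_mul]
    refine Finset.sum_congr rfl fun i _ => ?_
    rw [Finset.sum_mul]
    exact Finset.sum_congr rfl fun j _ => by ring
  · intro i j x
    exact h.S_bound (hc i j) fun t _ => hb i j t
  · intro m i j x
    rw [pd_cv (hc i j) (h.smooth.of_le (by simp)) h.cs, h.D_shift (hc i j) (α i j x)]
    refine (h.D_bound (B := ℓ * ε) ((hc i j).sub continuous_const) (by positivity) ?_ m).trans
      (le_of_eq ?_)
    · intro t ht
      refine (hl i j t x).trans ?_
      gcongr
    · field_simp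

theorem cutoff_exists {r R : ℝ} (hr : 0 < r) (hrR : r < R) {v : Euc k → ℝ}
    (hv : ContDiffOn ℝ 1 v (ball 0 R)) : ∃ V : Euc k → ℝ, ContDiff ℝ 1 V ∧ HasCompactSupport V ∧
      ∀ x ∈ ball (0 : Euc k) r, V x = v x := by
  let b : ContDiffBump (0 : Euc k) := ⟨r, (r + R) / 2, hr, by linarith⟩
  have hb : ContDiff ℝ 1 (b : Euc k → ℝ) := b.contDiff (n := 1)
  have hz : ∀ x : Euc k, (r + R) / 2 ≤ ‖x‖ → b x = 0 := fun x hx =>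
    b.zero_of_le_dist (by rwa [dist_zero_right])
  refine ⟨fun x => b x * v x, ?_, ?_, ?_⟩
  · rw [contDiff_iff_contDiffAt]
    intro x
    by_cases hx : ‖x‖ < R
    · exact hb.contDiffAt.mul (hv.contDiffAt (isOpen_ball.mem_nhds (by simpa using hx)))
    · have : (fun x => b x * v x) =ᶠ[𝓝 x] fun _ => 0 := by
        have ho : IsOpen {y : Euc k | (r + R) / 2 < ‖y‖} := isOpen_lt continuous_const continuous_norm
        filter_upwards [ho.mem_nhds (show (r + R) / 2 < ‖x‖ by linarith)] with y hy
        rw [hz y (le_of_lt hy), zero_mul]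
      exact contDiffAt_const.congr_of_eventuallyEq this
  · refine HasCompactSupport.intro (isCompact_closedBall (0 : Euc k) ((r + R) / 2)) fun x hx => ?_
    have : (r + R) / 2 < ‖x‖ := by simpa using hx
    rw [hz x this.le, zero_mul]
  · intro x hx
    have := b.one_of_mem_closedBall (x := x) (ball_subset_closedBall hx)
    simp only
    rw [this, one_mul]

theorem weak_kernel {C ε r R : ℝ} {ρ : Euc k → ℝ} (h : Ker C ε ρ) (hrR : r < R)
    {A : Euc k → Matrix (Fin k) (Fin k) ℝ} {v V : Euc k → ℝ} (hw : IsWeakSol A v (ball 0 R))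
    (hV : ContDiff ℝ 1 V) (hVv : ∀ x ∈ ball (0 : Euc k) r, V x = v x)
    {α : Fin k → Fin k → Euc k → ℝ} (hc : ∀ i j, Continuous (α i j))
    (hα : ∀ i j, ∀ x ∈ ball (0 : Euc k) r, α i j x = A x i j) {x : Euc k} (hx : ‖x‖ + ε ≤ r) :
    ∑ i, ∑ j, cv (fun t => α i j t * pd j V t) (pd i ρ) x = 0 := by
  have hpV : ∀ j, Continuous (pd j V) := fun j => by
    have := hV.continuous_fderiv (by simp)
    unfold pd
    fun_prop
  have hψ : ContDiff ℝ ∞ fun t => ρ (x - t) := h.smooth.comp (contDiff_const.sub contDiff_id)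
  have hball : ∀ t : Euc k, ‖x - t‖ < ε → ‖t‖ < r := fun t ht => by
    have := norm_sub_le x (x - t)
    rw [sub_sub_cancel] at this
    linarith
  have hts : tsupport (fun t => ρ (x - t)) ⊆ closedBall x ε := by
    refine closure_minimal ?_ isClosed_closedBall
    intro t ht
    by_contra hn
    refine ht (h.zero _ ?_)
    rw [mem_closedBall, dist_comm, dist_eq_norm] at hn
    linarith
  have hcsψ : HasCompactSupport fun t => ρ (x - t) :=
    (isCompact_closedBall x ε).of_isClosed_subset (isClosed_tsupport _) hts
  have hgr : ∀ i t, gradVec (fun t => ρ (x - t)) t i = - pd i ρ (x - t) := by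
    intro i t
    have h1 : HasFDerivAt (fun t => x - t) (-(ContinuousLinearMap.id ℝ (Euc k))) t := by
      simpa using (hasFDerivAt_id t).const_sub x
    have h2 := ((h.smooth.differentiable (by simp)) (x - t)).hasFDerivAt.comp t h1
    have h3 : fderiv ℝ (fun t => ρ (x - t)) t = _ := h2.fderiv
    unfold gradVec pd
    rw [h3]
    simp
  have hW := hw _ hψ hcsψ (hts.trans (by
    intro t ht
    rw [mem_closedBall, dist_eq_norm] at ht
    rw [mem_ball, dist_zero_right]
    have := norm_add_le x (t - x)
    rw [add_sub_cancel] at this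
    linarith))
  have key : ∀ t ∈ ball (0 : Euc k) R, aForm (A t) (gradVec v t) (gradVec (fun t => ρ (x - t)) t) =
      -∑ i, ∑ j, α i j t * pd j V t * pd i ρ (x - t) := by
    intro t _
    unfold aForm
    rw [← Finset.sum_neg_distrib]
    refine Finset.sum_congr rfl fun i _ => ?_
    rw [← Finset.sum_neg_distrib]
    refine Finset.sum_congr rfl fun j _ => ?_
    rw [hgr]
    by_cases ht : ‖x - t‖ < ε
    · have htr : t ∈ ball (0 : Euc k) r := by simpa using hball t ht
      have : pd j V t = gradVec v t j := by
        have : V =ᶠ[𝓝 t] v := by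
          filter_upwards [isOpen_ball.mem_nhds htr] with y hy using hVv y hy
        exact pd_congr this j
      rw [hα i j t htr, this]
      ring
    · rw [h.dzero i _ (not_lt.1 ht)]
      ring
  rw [setIntegral_congr_fun measurableSet_ball key, integral_neg, neg_eq_zero,
    setIntegral_eq_integral_of_forall_compl_eq_zero] at hW
  · have hI : ∀ i j, Integrable fun t => α i j t * pd j V t * pd i ρ (x - t) := fun i j =>
      cv_integrable (f := fun t => α i j t * pd j V t) ((hc i j).mul (hpV j))
        (pd_contDiff h.smooth i).continuous (pd_hasCompactSupport h.cs i) x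
    rw [integral_finsetSum _ fun i _ => integrable_finsetSum _ fun j _ => hI i j] at hW
    rw [← hW]
    refine Finset.sum_congr rfl fun i _ => ?_
    rw [integral_finsetSum _ fun j _ => hI i j]
    rfl
  · intro t ht
    refine Finset.sum_eq_zero fun i _ => Finset.sum_eq_zero fun j _ => ?_
    have : ε ≤ ‖x - t‖ := by
      by_contra hn
      have := hball t (not_le.1 hn)
      apply ht
      rw [mem_ball, dist_zero_right]
      linarith
    rw [h.dzero i _ this, mul_zero]

theorem approx {r₃ R Λ : ℝ} (L : ℝ≥0) (h3 : 0 < r₃) (h3R : r₃ < R) (hΛ : 1 ≤ Λ) :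
    ∃ L' : ℝ, 0 ≤ L' ∧ ∀ A : Euc k → Matrix (Fin k) (Fin k) ℝ,
        (∀ x ∈ ball (0 : Euc k) R, (A x).IsSymm) →
        LipEntries A L (ball 0 R) →
        UnifElliptic A Λ (ball 0 R) →
        ∀ v : Euc k → ℝ,
          ContDiffOn ℝ 1 v (ball 0 R) →
          IsWeakSol A v (ball 0 R) →
          ∀ η > 0, ∃ (a : Fin k → Fin k → Euc k → ℝ) (V : Euc k → ℝ), Ell Λ L' a ∧ ContDiff ℝ ∞ V ∧
            ∀ x ∈ ball (0 : Euc k) r₃, |V x - v x| ≤ η ∧ |Lop a V x| ≤ η := by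
  obtain ⟨C, hC, hker⟩ := kernel_exists k
  refine ⟨2 * L * C, by positivity, ?_⟩
  intro A hsym hLip hell v hv hw η hη
  obtain ⟨r, hr3, hrR⟩ := exists_between h3R
  have hr : 0 < r := h3.trans hr3
  obtain ⟨V₀, hV₀, hV₀c, hV₀v⟩ := cutoff_exists hr hrR hv
  have hpV : ∀ j, Continuous (pd j V₀) := fun j => by
    have := hV₀.continuous_fderiv (by simp)
    unfold pd
    fun_prop
  have hrad : ∀ t : Euc k, rad r t ∈ ball (0 : Euc k) R := fun t => by
    rw [mem_ball, dist_zero_right]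
    exact (rad_norm hr t).trans_lt hrR
  let α : Fin k → Fin k → Euc k → ℝ := fun i j t => A (rad r t) i j
  have hl : ∀ i j t x, |α i j t - α i j x| ≤ (2 * L : ℝ) * ‖x - t‖ := by
    intro i j t x
    have h1 := (hLip i j).dist_le_mul _ (hrad t) _ (hrad x)
    rw [Real.dist_eq, dist_eq_norm] at h1
    refine h1.trans ?_
    have h2 := rad_lip hr t x
    rw [norm_sub_rev t x] at h2
    calc (L : ℝ) * ‖rad r t - rad r x‖ ≤ L * (2 * ‖x - t‖) := by gcongr
      _ = _ := by ring
  have hc : ∀ i j, Continuous (α i j) := by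
    intro i j
    refine (LipschitzWith.of_dist_le_mul (K := 2 * L) fun t x => ?_).continuous
    rw [Real.dist_eq, dist_comm, dist_eq_norm]
    simpa using hl i j t x
  -- uniform continuity
  set w₀ : ℝ := η / (6 * k * k * L * C + 1) with hw₀
  have hw₀p : 0 < w₀ := by positivity
  have uV := Metric.uniformContinuous_iff.1 (hV₀c.uniformContinuous_of_continuous hV₀.continuous) η hη
  obtain ⟨δ₁, hδ₁, u1⟩ := uV
  have uP : UniformContinuous fun t : Euc k => fun j : Fin k => pd j V₀ t :=
    uniformContinuous_pi.2 fun j =>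
      (pd_hasCompactSupport hV₀c j).uniformContinuous_of_continuous (hpV j)
  obtain ⟨δ₂, hδ₂, u2⟩ := Metric.uniformContinuous_iff.1 uP w₀ hw₀p
  set ε : ℝ := min (min δ₁ δ₂) (r - r₃) with hεd
  have hε : 0 < ε := lt_min (lt_min hδ₁ hδ₂) (by linarith)
  have hε1 : ε ≤ δ₁ := (min_le_left _ _).trans (min_le_left _ _)
  have hε2 : ε ≤ δ₂ := (min_le_left _ _).trans (min_le_right _ _)
  have hε3 : ε ≤ r - r₃ := min_le_right _ _
  obtain ⟨ρ, k1, k2, k3, k4, k5, k6, k7⟩ := hker ε hε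
  have h : Ker C ε ρ := ⟨k1, k2, k3, k4, k5, k6, k7⟩
  have hE : Ell Λ (2 * L * C) (fun i j => cv (α i j) ρ) := by
    refine ell_mollify h hε (by positivity) hc hl ?_ ?_ ?_
    · intro i j t
      exact (hsym _ (hrad t)).apply j i
    · intro t ξ
      exact (hell _ (hrad t) ξ).1
    · intro i j t
      exact entry_bound hΛ (hsym _ (hrad t)) (hell _ (hrad t)) i j
  have hVs : ContDiff ℝ ∞ (cv V₀ ρ) := cv_contDiff hV₀.continuous h.smooth h.cs
  refine ⟨_, cv V₀ ρ, hE, hVs, ?_⟩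
  intro x hx
  have hxn : ‖x‖ < r₃ := by simpa using hx
  constructor
  · have hxr : x ∈ ball (0 : Euc k) r := by
      rw [mem_ball, dist_zero_right]; linarith
    rw [h.S_shift hV₀.continuous (V₀ x), ← hV₀v x hxr, add_sub_cancel_right]
    refine h.S_bound (hV₀.continuous.sub continuous_const) fun t ht => ?_
    have := u1 (a := t) (b := x) (by rw [dist_comm, dist_eq_norm]; linarith)
    rw [Real.dist_eq] at this
    exact this.le
  · have hwk := weak_kernel h hrR hw hV₀ hV₀v hc (by
      intro i j t ht
      rw [mem_ball, dist_zero_right] at ht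
      simp only [α]
      rw [rad_id hr ht.le]) (x := x) (by linarith)
    have hp1 : ∀ j, pd j (cv V₀ ρ) = cv (pd j V₀) ρ := fun j => by
      rw [cv_comm, pd_cv h.smooth.continuous hV₀ hV₀c, cv_comm]
    have e : Lop (fun i j => cv (α i j) ρ) (cv V₀ ρ) x = ∑ i, ∑ j,
        (cv (α i j) (pd i ρ) x * cv (pd j V₀) ρ x + cv (α i j) ρ x * cv (pd j V₀) (pd i ρ) x
          - cv (fun t => α i j t * pd j V₀ t) (pd i ρ) x) := by
      simp only [Finset.sum_sub_distrib]
      rw [hwk, sub_zero]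
      unfold Lop
      refine Finset.sum_congr rfl fun i _ => ?_
      rw [pd_flux hE.smooth hVs]
      refine Finset.sum_congr rfl fun j _ => ?_
      rw [hp1, pd_cv (hc i j) (h.smooth.of_le (by simp)) h.cs,
        pd_cv (hpV j) (h.smooth.of_le (by simp)) h.cs]
    rw [e]
    have hb : ∀ i j, |cv (α i j) (pd i ρ) x * cv (pd j V₀) ρ x
        + cv (α i j) ρ x * cv (pd j V₀) (pd i ρ) x
          - cv (fun t => α i j t * pd j V₀ t) (pd i ρ) x| ≤ 3 * ((2 * L) * C * w₀) := by
      intro i j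
      refine h.comm hε hC (by positivity) hw₀p.le (hc i j) (hpV j) ?_ ?_ i
      · intro t ht
        refine (hl i j t x).trans ?_
        gcongr
      · intro t ht
        have h1 := u2 (a := t) (b := x) (by rw [dist_comm, dist_eq_norm]; linarith)
        have h2 := dist_le_pi_dist (fun j : Fin k => pd j V₀ t) (fun j : Fin k => pd j V₀ x) j
        rw [Real.dist_eq] at h2
        exact h2.trans h1.le
    refine (abs_sum_le' fun i => abs_sum_le' fun j => hb i j).trans ?_
    have : (k : ℝ) * (k * (3 * ((2 * L) * C * w₀))) = η * ((6 * k * k * L * C) / (6 * k * k * L * C + 1)) := by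
      rw [hw₀]; ring
    rw [this]
    refine mul_le_of_le_one_right hη.le ?_
    rw [div_le_one (by positivity)]
    linarith
end approx2

section concl
variable {k : ℕ}

theorem opt_lemma {I1 I2 I3 C δ τ₀ : ℝ} (h1 : 0 ≤ I1) (h13 : I1 ≤ I3) (hC : 0 < C)
    (hδ : 0 < δ) (hτ₀ : 0 < τ₀)
    (H : ∀ τ, τ₀ ≤ τ → I2 ≤ C * (Real.exp (2 * τ) * I1 + Real.exp (-(2 * δ * τ)) * I3)) :
    I2 ≤ C * (Real.exp (2 * τ₀) + 1) * (I1 ^ (δ / (1 + δ)) * I3 ^ (1 - δ / (1 + δ))) := by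
  rcases h1.eq_or_lt with h0 | h0
  · have hβ : δ / (1 + δ) ≠ 0 := by positivity
    rw [← h0, Real.zero_rpow hβ, zero_mul, mul_zero]
    have ht : Filter.Tendsto (fun τ : ℝ => C * (Real.exp (-(2 * δ * τ)) * I3)) Filter.atTop
        (𝓝 (C * (0 * I3))) := by
      refine Filter.Tendsto.const_mul _ (Filter.Tendsto.mul_const _ ?_)
      refine Real.tendsto_exp_neg_atTop_nhds_zero.comp ?_
      exact Filter.tendsto_id.const_mul_atTop (by positivity)
    rw [zero_mul, mul_zero] at ht
    refine ge_of_tendsto ht ?_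
    filter_upwards [Filter.eventually_ge_atTop τ₀] with τ hτ
    have := H τ hτ
    rwa [← h0, mul_zero, zero_add] at this
  · obtain ⟨p, rfl⟩ : ∃ p, Real.exp p = I1 := ⟨Real.log I1, Real.exp_log h0⟩
    obtain ⟨q, rfl⟩ : ∃ q, Real.exp q = I3 := ⟨Real.log I3, Real.exp_log (h0.trans_le h13)⟩
    have hpq : p ≤ q := Real.exp_le_exp.1 h13
    have hs : 0 ≤ (q - p) / (2 * (1 + δ)) := div_nonneg (by linarith) (by positivity)
    have := H (τ₀ + (q - p) / (2 * (1 + δ))) (by linarith)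
    refine this.trans ?_
    rw [mul_assoc C]
    refine mul_le_mul_of_nonneg_left ?_ hC.le
    rw [← Real.exp_mul, ← Real.exp_mul, ← Real.exp_add, ← Real.exp_add, ← Real.exp_add, add_mul,
      ← Real.exp_add, one_mul]
    refine add_le_add (le_of_eq ?_) ?_
    · congr 1
      field_simp
      ring
    · rw [Real.exp_le_exp]
      have e : -(2 * δ * (τ₀ + (q - p) / (2 * (1 + δ)))) + q =
        p * (δ / (1 + δ)) + q * (1 - δ / (1 + δ)) - 2 * δ * τ₀ := by
        field_simp
        ring
      rw [e]
      have : 0 < 2 * δ * τ₀ := by positivity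
      linarith

theorem sq_close {f g : Euc k → ℝ} {r r₃ η : ℝ} (hr : r ≤ r₃)
    (hf : IntegrableOn (fun x => f x ^ 2) (ball 0 r)) (hg : IntegrableOn (fun x => g x ^ 2) (ball 0 r))
    (h : ∀ x ∈ ball (0 : Euc k) r₃, |f x - g x| ≤ η) :
    ∫ x in ball 0 r, f x ^ 2 ≤ 2 * (∫ x in ball 0 r, g x ^ 2)
      + 2 * η ^ 2 * volume.real (ball (0 : Euc k) r₃) := by
  have hv : volume.real (ball (0 : Euc k) r) ≤ volume.real (ball (0 : Euc k) r₃) :=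
    measureReal_mono (ball_subset_ball hr) measure_ball_lt_top.ne
  have hc : IntegrableOn (fun _ : Euc k => 2 * η ^ 2) (ball (0 : Euc k) r) :=
    integrableOn_const measure_ball_lt_top.ne
  have : ∫ x in ball 0 r, f x ^ 2 ≤ ∫ x in ball (0 : Euc k) r, (2 * g x ^ 2 + 2 * η ^ 2) := by
    refine setIntegral_mono_on hf ((hg.const_mul 2).add hc) measurableSet_ball fun x hx => ?_
    have h1 := h x (ball_subset_ball hr hx)
    have h2 : (f x - g x) ^ 2 ≤ η ^ 2 := by
      rw [← sq_abs (f x - g x)]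
      gcongr
    nlinarith [sq_nonneg (f x - 2 * g x)]
  refine this.trans ?_
  rw [integral_add (hg.const_mul 2) hc, integral_const_mul, setIntegral_const, smul_eq_mul]
  have : 0 ≤ η ^ 2 := sq_nonneg η
  nlinarith

theorem three_limit (R : ℝ) (L : ℝ≥0) (Λ : ℝ) (hΛ : 1 ≤ Λ)
    (r₁ r₂ r₃ : ℝ) (h1 : 0 < r₁) (h12 : r₁ < r₂) (h23 : r₂ < r₃) (h3R : r₃ < R) :
    ∃ N > (0 : ℝ), ∃ δ > (0 : ℝ), ∃ τ₀ > (0 : ℝ),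
      ∀ A : Euc k → Matrix (Fin k) (Fin k) ℝ,
        (∀ x ∈ ball (0 : Euc k) R, (A x).IsSymm) →
        LipEntries A L (ball 0 R) →
        UnifElliptic A Λ (ball 0 R) →
        ∀ v : Euc k → ℝ,
          ContDiffOn ℝ 1 v (ball 0 R) →
          IsWeakSol A v (ball 0 R) → ∀ τ, τ₀ ≤ τ →
          ∫ x in ball 0 r₂, v x ^ 2 ≤ N * (Real.exp (2 * τ) * (∫ x in ball 0 r₁, v x ^ 2) +
            Real.exp (-(2 * δ * τ)) * ∫ x in ball 0 r₃, v x ^ 2) := by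
  have h3 : 0 < r₃ := by linarith
  obtain ⟨L', hL', happ⟩ := approx (k := k) L h3 h3R hΛ
  obtain ⟨N, hN, δ, hδ, τ₀, hτ₀, H⟩ := three_smooth (k := k) (Λ := Λ) (by linarith) hL' h1 h12 h23
  refine ⟨4 * N, by positivity, δ, hδ, τ₀, hτ₀, ?_⟩
  intro A hs hl he v hv hw τ hτ
  have hvi : IntegrableOn (fun x => v x ^ 2) (ball (0 : Euc k) r₃) := by
    have hcv : ContinuousOn v (closedBall 0 r₃) :=
      hv.continuousOn.mono (closedBall_subset_ball h3R)
    have hcv2 : ContinuousOn (fun x => v x ^ 2) (closedBall 0 r₃) := by fun_prop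
    exact (hcv2.integrableOn_compact (isCompact_closedBall _ _)).mono_set ball_subset_closedBall
  set M := volume.real (ball (0 : Euc k) r₃) with hM
  have hM0 : 0 ≤ M := measureReal_nonneg
  set E := Real.exp (2 * τ)
  set F := Real.exp (-(2 * δ * τ))
  have hE : 0 < E := Real.exp_pos _
  have hF : 0 < F := Real.exp_pos _
  set K : ℝ := 2 * N * (E * (3 * M) + F * (2 * M)) + 2 * M with hK
  have hK0 : 0 ≤ K := by positivity
  refine le_of_forall_pos_le_add fun e he0 => ?_
  have hη : 0 < √(e / (K + 1)) := Real.sqrt_pos.2 (by positivity)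
  obtain ⟨a, V, hEll, hV, hcl⟩ := happ A hs hl he v hv hw _ hη
  set η := √(e / (K + 1)) with hηd
  have hη2 : η ^ 2 = e / (K + 1) := Real.sq_sqrt (by positivity)
  have hKe : η ^ 2 * K ≤ e := by
    rw [hη2, div_mul_eq_mul_div, div_le_iff₀ (by positivity)]
    nlinarith
  have hVc : Continuous fun x => V x ^ 2 := by
    have := hV.continuous
    fun_prop
  have main := H τ hτ a hEll V hV
  have c1 : ∀ x ∈ ball (0 : Euc k) r₃, |V x - v x| ≤ η := fun x hx => (hcl x hx).1
  have c2 : ∀ x ∈ ball (0 : Euc k) r₃, |v x - V x| ≤ η := fun x hx => by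
    rw [abs_sub_comm]; exact c1 x hx
  have b2 := sq_close h23.le (hvi.mono_set (ball_subset_ball h23.le)) (intOn_ball hVc r₂) c2
  have b1 := sq_close (by linarith : r₁ ≤ r₃) (intOn_ball hVc r₁)
    (hvi.mono_set (ball_subset_ball (by linarith))) c1
  have b3 := sq_close le_rfl (intOn_ball hVc r₃) hvi c1
  have b4 : ∫ x in ball (0 : Euc k) r₃, Lop a V x ^ 2 ≤ η ^ 2 * M := by
    have hLc : Continuous fun x => Lop a V x ^ 2 := by
      have := (Lop_contDiff hEll.smooth hV).continuous
      fun_prop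
    have : ∫ x in ball (0 : Euc k) r₃, Lop a V x ^ 2 ≤ ∫ x in ball (0 : Euc k) r₃, η ^ 2 := by
      refine setIntegral_mono_on (intOn_ball hLc r₃) (integrableOn_const measure_ball_lt_top.ne)
        measurableSet_ball fun x hx => ?_
      rw [← sq_abs]
      have := (hcl x hx).2
      gcongr
    rwa [setIntegral_const, smul_eq_mul, mul_comm] at this
  rw [← hM] at b1 b2 b3
  generalize (∫ x in ball (0 : Euc k) r₃, Lop a V x ^ 2) = Q at main b4
  generalize (∫ x in ball (0 : Euc k) r₁, V x ^ 2) = J1 at main b1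
  generalize (∫ x in ball (0 : Euc k) r₂, V x ^ 2) = J2 at main b2
  generalize (∫ x in ball (0 : Euc k) r₃, V x ^ 2) = J3 at main b3
  generalize (∫ x in ball (0 : Euc k) r₃, v x ^ 2) = I3 at b3 ⊢
  generalize (∫ x in ball (0 : Euc k) r₂, v x ^ 2) = I2 at b2 ⊢
  generalize (∫ x in ball (0 : Euc k) r₁, v x ^ 2) = I1 at b1 ⊢
  have m1 : E * (J1 + Q) ≤ E * ((2 * I1 + 2 * η ^ 2 * M) + η ^ 2 * M) :=
    mul_le_mul_of_nonneg_left (add_le_add b1 b4) hE.le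
  have m2 : F * J3 ≤ F * (2 * I3 + 2 * η ^ 2 * M) := mul_le_mul_of_nonneg_left b3 hF.le
  have m3 := main.trans (mul_le_mul_of_nonneg_left (add_le_add m1 m2) hN.le)
  calc I2 ≤ 2 * J2 + 2 * η ^ 2 * M := b2
    _ ≤ 2 * (N * (E * ((2 * I1 + 2 * η ^ 2 * M) + η ^ 2 * M) + F * (2 * I3 + 2 * η ^ 2 * M)))
        + 2 * η ^ 2 * M := by linarith
    _ = 4 * N * (E * I1 + F * I3) + η ^ 2 * K := by rw [hK]; ring
    _ ≤ _ := by linarith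

end concl

/-- **Three-spheres inequality.** Let `A` be a symmetric, uniformly elliptic
(with constant `Λ`) matrix-valued function with `L`-Lipschitz entries on `B_R = B(0,R) ⊆ ℝᵏ`,
and let `v ∈ W^{1,2}_loc(B_R)` be a weak solution of `div(A∇v) = 0` in `B_R`. Then for every
`0 < r₁ < r₂ < r₃ < R` there exist `C > 0` and `β ∈ (0,1)`, depending only on
`R, r₁, r₂, r₃, L, Λ` (and `k`), such that
`‖v‖_{L²(B_{r₂})} ≤ C ‖v‖_{L²(B_{r₁})}^β ‖v‖_{L²(B_{r₃})}^{1−β}`. -/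
theorem statement_8 (k : ℕ) (R : ℝ) (hR : 0 < R) (L : ℝ≥0) (Λ : ℝ) (hΛ : 1 ≤ Λ)
    (r₁ r₂ r₃ : ℝ) (h1 : 0 < r₁) (h12 : r₁ < r₂) (h23 : r₂ < r₃) (h3R : r₃ < R) :
    ∃ C > (0 : ℝ), ∃ β : ℝ, 0 < β ∧ β < 1 ∧
      ∀ A : Euc k → Matrix (Fin k) (Fin k) ℝ,
        (∀ x ∈ ball (0 : Euc k) R, (A x).IsSymm) →
        LipEntries A L (ball 0 R) →
        UnifElliptic A Λ (ball 0 R) →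
        ∀ v : Euc k → ℝ,
          ContDiffOn ℝ 1 v (ball 0 R) →
          IsWeakSol A v (ball 0 R) →
          l2norm v (ball 0 r₂) ≤
            C * l2norm v (ball 0 r₁) ^ β * l2norm v (ball 0 r₃) ^ (1 - β) := by
  obtain ⟨N, hN, δ, hδ, τ₀, hτ₀, H⟩ := three_limit (k := k) R L Λ hΛ r₁ r₂ r₃ h1 h12 h23 h3R
  have hD : 0 < N * (Real.exp (2 * τ₀) + 1) := by positivity
  refine ⟨√(N * (Real.exp (2 * τ₀) + 1)), Real.sqrt_pos.2 hD, δ / (1 + δ), by positivity, ?_, ?_⟩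
  · rw [div_lt_one (by positivity)]
    linarith
  intro A hs hl he v hv hw
  have hvi : IntegrableOn (fun x => v x ^ 2) (ball (0 : Euc k) r₃) := by
    have hcv : ContinuousOn v (closedBall 0 r₃) :=
      hv.continuousOn.mono (closedBall_subset_ball h3R)
    have hcv2 : ContinuousOn (fun x => v x ^ 2) (closedBall 0 r₃) := by fun_prop
    exact (hcv2.integrableOn_compact (isCompact_closedBall _ _)).mono_set ball_subset_closedBall
  have n1 : 0 ≤ ∫ x in ball (0 : Euc k) r₁, v x ^ 2 := integral_nonneg fun x => sq_nonneg _
  have n3 : 0 ≤ ∫ x in ball (0 : Euc k) r₃, v x ^ 2 := integral_nonneg fun x => sq_nonneg _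
  have h13 : ∫ x in ball (0 : Euc k) r₁, v x ^ 2 ≤ ∫ x in ball (0 : Euc k) r₃, v x ^ 2 :=
    setIntegral_mono_set hvi (Filter.Eventually.of_forall fun x => sq_nonneg _)
      (ball_subset_ball (by linarith)).eventuallyLE
  have key := opt_lemma n1 h13 hN hδ hτ₀ (H A hs hl he v hv hw)
  have key2 := Real.sqrt_le_sqrt key
  unfold l2norm
  refine key2.trans (le_of_eq ?_)
  rw [Real.sqrt_mul hD.le, Real.sqrt_mul (Real.rpow_nonneg n1 _), mul_assoc]
  have sw : ∀ x s : ℝ, 0 ≤ x → √(x ^ s) = √x ^ s := by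
    intro x s hx
    rw [Real.sqrt_eq_rpow, Real.sqrt_eq_rpow, ← Real.rpow_mul hx, ← Real.rpow_mul hx, mul_comm]
  rw [sw _ _ n1, sw _ _ n3]
end
end

section
/- Let φ : ℝ^{n−1} → ℝ be differentiable with bounded, Lipschitz gradient, let ν(x) = (∇φ(x), −1)/√(1 + |∇φ(x)|²) be the downward-graph unit normal, let η ∈ C_c^∞(ℝ^{n−1}) be the standard normalized bump supported in the unit ball, η_s(x) = s^{−(n−1)}η(x/s), and define F(x,s) = (x, φ(x)) − s·(η_s * ν)(x) for (x,s) ∈ ℝ^{n−1} × (0,∞), where the convolution is applied componentwise to ν. Then the total derivative DF is Lipschitz on ℝ^{n−1} × (0,∞): there exists L > 0 such that ‖DF(x₁,s₁) − DF(x₂,s₂)‖ ≤ L·|(x₁−x₂, s₁−s₂)| for all x₁, x₂ ∈ ℝ^{n−1} and s₁, s₂ > 0. -/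
open MeasureTheory Metric Set Filter
open scoped ENNReal NNReal Topology ContDiff

noncomputable section

/-- The standard bump function `η(x) = C e^{1/(|x|²-1)}` for `|x| < 1`, `0` otherwise. -/
def bump (d : ℕ) (C : ℝ) (x : Euc d) : ℝ :=
  if ‖x‖ < 1 then C * Real.exp (1 / (‖x‖ ^ 2 - 1)) else 0

/-- The rescaled mollifier `η_s(x) = s^{-d} η(x/s)`. -/
def bumpS (d : ℕ) (C : ℝ) (s : ℝ) (x : Euc d) : ℝ :=
  (s ^ d)⁻¹ * bump d C (s⁻¹ • x)

/-- The downward-graph unit normal `ν(x) = (∇φ(x), −1)/√(1 + |∇φ(x)|²)`. -/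
def normalVec {d : ℕ} (φ : Euc d → ℝ) (x : Euc d) : Euc d × ℝ :=
  (Real.sqrt (1 + ‖gradient φ x‖ ^ 2))⁻¹ • (gradient φ x, (-1 : ℝ))

/-- The componentwise convolution `(η_s * ν)(x) = ∫ η_s(y) ν(x−y) dy`. -/
def convNormal {d : ℕ} (C : ℝ) (φ : Euc d → ℝ) (s : ℝ) (x : Euc d) : Euc d × ℝ :=
  ∫ y : Euc d, bumpS d C s y • normalVec φ (x - y)

/-- `F(x,s) = (x, φ(x)) − s (η_s * ν)(x)`. -/
def Fmap {d : ℕ} (C : ℝ) (φ : Euc d → ℝ) (p : Euc d × ℝ) : Euc d × ℝ :=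
  ((p.1, φ p.1) : Euc d × ℝ) - p.2 • convNormal C φ p.2 p.1

/-- `G(x,s) = (x, φ(x)) + s (η_s * ν)(x)`. -/
def Gmap {d : ℕ} (C : ℝ) (φ : Euc d → ℝ) (p : Euc d × ℝ) : Euc d × ℝ :=
  ((p.1, φ p.1) : Euc d × ℝ) + p.2 • convNormal C φ p.2 p.1

/-- The two-sided extension `F̃(x,s)`: `F(x,s)` for `s ≥ 0` (with `F̃(x,0) = (x,φ(x))`)
and `G(x,−s)` for `s < 0`. -/
def Ftil {d : ℕ} (C : ℝ) (φ : Euc d → ℝ) (p : Euc d × ℝ) : Euc d × ℝ :=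
  if 0 ≤ p.2 then Fmap C φ p else Gmap C φ (p.1, -p.2)

lemma bump_eq (d : ℕ) (C : ℝ) (x : Euc d) :
    bump d C x = C * expNegInvGlue (1 - ‖x‖ ^ 2) := by
  unfold bump expNegInvGlue
  by_cases h : ‖x‖ < 1
  · have h2 : ¬ (1 - ‖x‖ ^ 2 ≤ 0) := by nlinarith [norm_nonneg x]
    rw [if_pos h, if_neg h2, ← inv_neg, neg_sub, one_div]
  · have h2 : (1 - ‖x‖ ^ 2 ≤ 0) := by nlinarith [norm_nonneg x]
    rw [if_neg h, if_pos h2, mul_zero]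

lemma bump_contDiff (d : ℕ) (C : ℝ) : ContDiff ℝ ∞ (bump d C) := by
  have : bump d C = fun x => C * expNegInvGlue (1 - ‖x‖ ^ 2) := funext (bump_eq d C)
  rw [this]
  exact contDiff_const.mul (expNegInvGlue.contDiff.comp (contDiff_const.sub (contDiff_norm_sq ℝ)))

lemma bump_nonneg (d : ℕ) (C : ℝ) (hC : 0 < C) (x : Euc d) : 0 ≤ bump d C x := by
  rw [bump_eq]
  exact mul_nonneg hC.le (expNegInvGlue.nonneg _)

def kerK (d : ℕ) (C : ℝ) (p : Euc d × ℝ) : ℝ :=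
  p.2 * ((p.2 ^ d)⁻¹ * bump d C (p.2⁻¹ • p.1))

lemma ker_contDiffAt (d : ℕ) (C : ℝ) (p : Euc d × ℝ) (hp : 0 < p.2) :
    ContDiffAt ℝ ∞ (kerK d C) p := by
  unfold kerK
  have h2 : ContDiffAt ℝ ∞ (fun p : Euc d × ℝ => p.2) p := contDiffAt_snd
  refine h2.mul (((h2.pow d).inv (by positivity)).mul ?_)
  exact (bump_contDiff d C).contDiffAt.comp p ((h2.inv hp.ne').smul contDiffAt_fst)

lemma ker_zero (d : ℕ) (C : ℝ) (y : Euc d) (s : ℝ) (hs : 0 < s) (h : s ≤ ‖y‖) :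
    kerK d C (y, s) = 0 := by
  have : ¬ ‖s⁻¹ • y‖ < 1 := by
    rw [norm_smul, norm_inv, Real.norm_of_nonneg hs.le, not_lt, ← div_eq_inv_mul, one_le_div hs]
    exact h
  simp [kerK, bump, this]

lemma ker_smul (d : ℕ) (C : ℝ) (t : ℝ) (ht : 0 < t) (p : Euc d × ℝ) :
    kerK d C (t • p) = (t * (t ^ d)⁻¹) * kerK d C p := by
  simp only [kerK, Prod.smul_fst, Prod.smul_snd, smul_eq_mul, mul_inv, mul_pow, smul_smul]
  rw [show t⁻¹ * p.2⁻¹ * t = p.2⁻¹ by field_simp]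
  ring

lemma dker_smul (d : ℕ) (C : ℝ) (t : ℝ) (ht : 0 < t) (p : Euc d × ℝ) (hp : 0 < p.2) :
    fderiv ℝ (kerK d C) (t • p) = (t ^ d)⁻¹ • fderiv ℝ (kerK d C) p := by
  have hd : ∀ q : Euc d × ℝ, 0 < q.2 → HasFDerivAt (kerK d C) (fderiv ℝ (kerK d C) q) q :=
    fun q hq => ((ker_contDiffAt d C q hq).differentiableAt (by simp)).hasFDerivAt
  have htp : 0 < (t • p).2 := mul_pos ht hp
  have h1 : HasFDerivAt (fun q => kerK d C (t • q))
      ((fderiv ℝ (kerK d C) (t • p)).comp (t • ContinuousLinearMap.id ℝ (Euc d × ℝ))) p :=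
    HasFDerivAt.comp p (hd _ htp) ((hasFDerivAt_id p).const_smul t)
  have h2 : HasFDerivAt (fun q => kerK d C (t • q))
      ((t * (t ^ d)⁻¹) • fderiv ℝ (kerK d C) p) p := by
    have := (hd p hp).const_mul (t * (t ^ d)⁻¹)
    simpa only [ker_smul d C t ht] using this
  have h3 := h1.unique h2
  have h4 : t • fderiv ℝ (kerK d C) (t • p) = t • ((t ^ d)⁻¹ • fderiv ℝ (kerK d C) p) := by
    rw [smul_smul, ← h3]
    ext <;> simp
  exact smul_right_injective _ ht.ne' h4

lemma dker_zero (d : ℕ) (C : ℝ) (hC : 0 < C) (y : Euc d) (s : ℝ) (hs : 0 < s) (h : s ≤ ‖y‖) :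
    fderiv ℝ (kerK d C) (y, s) = 0 := by
  apply IsLocalMin.fderiv_eq_zero
  have : ∀ᶠ p : Euc d × ℝ in 𝓝 (y, s), 0 < p.2 :=
    (isOpen_lt continuous_const continuous_snd).mem_nhds hs
  filter_upwards [this] with p hp
  rw [ker_zero d C y s hs h]
  exact mul_nonneg hp.le (mul_nonneg (by positivity) (bump_nonneg d C hC _))

lemma dker_cont (d : ℕ) (C : ℝ) (s : ℝ) (hs : 0 < s) :
    Continuous (fun y : Euc d => fderiv ℝ (kerK d C) (y, s)) := by
  rw [continuous_iff_continuousAt]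
  intro y
  have h := ((ker_contDiffAt d C (y, s) hs).fderiv_right (m := 0) (by simp)).continuousAt
  exact ContinuousAt.comp (f := fun y : Euc d => (y, s)) h (by fun_prop)

lemma ker_cont (d : ℕ) (C : ℝ) (s : ℝ) (hs : 0 < s) :
    Continuous (fun y : Euc d => kerK d C (y, s)) := by
  rw [continuous_iff_continuousAt]
  intro y
  have h := (ker_contDiffAt d C (y, s) hs).continuousAt
  exact ContinuousAt.comp (f := fun y : Euc d => (y, s)) h (by fun_prop)

lemma supp_of {d : ℕ} {E : Type*} [NormedAddCommGroup E] (f : Euc d → E) (s : ℝ)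
    (h : ∀ y, s ≤ ‖y‖ → f y = 0) : HasCompactSupport f := by
  apply HasCompactSupport.intro (isCompact_closedBall (0 : Euc d) s)
  intro y hy
  apply h
  simp only [mem_closedBall, dist_zero_right, not_le] at hy
  exact hy.le

lemma sqrt_lip (a b : ℝ) (ha : 0 ≤ a) (hb : 0 ≤ b) :
    |Real.sqrt (1 + a ^ 2) - Real.sqrt (1 + b ^ 2)| ≤ |a - b| := by
  have h1 := Real.sq_sqrt (show 0 ≤ 1 + a ^ 2 by positivity)
  have h2 := Real.sq_sqrt (show 0 ≤ 1 + b ^ 2 by positivity)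
  have h3 := Real.sqrt_nonneg (1 + a ^ 2)
  have h4 := Real.sqrt_nonneg (1 + b ^ 2)
  apply sq_le_sq.1
  set u := Real.sqrt (1 + a ^ 2)
  set v := Real.sqrt (1 + b ^ 2)
  have : 1 + a * b ≤ u * v := by
    apply abs_le_of_sq_le_sq' _ (by positivity) |>.2
    rw [mul_pow, h1, h2]
    nlinarith [sq_nonneg (a - b)]
  nlinarith

lemma normal_lip {d : ℕ} (u v : Euc d) :
    ‖(Real.sqrt (1 + ‖u‖ ^ 2))⁻¹ • ((u, (-1 : ℝ)) : Euc d × ℝ) -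
      (Real.sqrt (1 + ‖v‖ ^ 2))⁻¹ • (v, (-1 : ℝ))‖ ≤ 2 * ‖u - v‖ := by
  have h := (sqrt_lip ‖u‖ ‖v‖ (norm_nonneg _) (norm_nonneg _)).trans (abs_norm_sub_norm_le u v)
  have ha1 : 1 ≤ Real.sqrt (1 + ‖u‖ ^ 2) := Real.one_le_sqrt.2 (by nlinarith [norm_nonneg u])
  have hb1 : 1 ≤ Real.sqrt (1 + ‖v‖ ^ 2) := Real.one_le_sqrt.2 (by nlinarith [norm_nonneg v])
  have hbv : ‖v‖ ≤ Real.sqrt (1 + ‖v‖ ^ 2) := Real.le_sqrt_of_sq_le (by linarith)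
  set a := Real.sqrt (1 + ‖u‖ ^ 2)
  set b := Real.sqrt (1 + ‖v‖ ^ 2)
  have hr : |a⁻¹ - b⁻¹| * b ≤ ‖u - v‖ := by
    have e : a⁻¹ - b⁻¹ = (b - a) * (a⁻¹ * b⁻¹) := by field_simp
    have e2 : |a⁻¹ - b⁻¹| * b = |a - b| * a⁻¹ := by
      rw [e, abs_mul, abs_sub_comm, abs_of_pos (show 0 < a⁻¹ * b⁻¹ by positivity)]
      field_simp
    rw [e2]
    calc |a - b| * a⁻¹ ≤ |a - b| * 1 := by
          gcongr
          exact inv_le_one_of_one_le₀ ha1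
      _ ≤ _ := by linarith
  have hn := norm_nonneg (u - v)
  have hai : a⁻¹ ≤ 1 := inv_le_one_of_one_le₀ ha1
  rw [Prod.norm_def, max_le_iff]
  constructor
  · have : (a⁻¹ • ((u, (-1 : ℝ)) : Euc d × ℝ) - b⁻¹ • (v, (-1 : ℝ))).1
        = a⁻¹ • (u - v) + (a⁻¹ - b⁻¹) • v := by
      simp only [Prod.fst_sub, Prod.smul_fst, smul_sub, sub_smul]; abel
    rw [this]
    refine (norm_add_le _ _).trans ?_
    rw [norm_smul, norm_smul, Real.norm_of_nonneg (by positivity), Real.norm_eq_abs]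
    have : |a⁻¹ - b⁻¹| * ‖v‖ ≤ |a⁻¹ - b⁻¹| * b := by gcongr
    nlinarith
  · have : (a⁻¹ • ((u, (-1 : ℝ)) : Euc d × ℝ) - b⁻¹ • (v, (-1 : ℝ))).2 = -(a⁻¹ - b⁻¹) := by
      simp only [Prod.snd_sub, Prod.smul_snd, smul_eq_mul]; ring
    rw [this, norm_neg, Real.norm_eq_abs]
    have : |a⁻¹ - b⁻¹| * 1 ≤ |a⁻¹ - b⁻¹| * b := by gcongr
    linarith

lemma nu_lip {d : ℕ} (φ : Euc d → ℝ) (K : ℝ≥0) (hLip : LipschitzWith K (gradient φ)) (x y : Euc d) :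
    ‖normalVec φ x - normalVec φ y‖ ≤ 2 * K * ‖x - y‖ := by
  refine (normal_lip (gradient φ x) (gradient φ y)).trans ?_
  have := hLip.dist_le_mul x y
  rw [dist_eq_norm, dist_eq_norm] at this
  linarith

lemma conv_eq {d : ℕ} (C : ℝ) (φ : Euc d → ℝ) (p : Euc d × ℝ) :
    p.2 • convNormal C φ p.2 p.1 = ∫ w : Euc d, kerK d C (p.1 - w, p.2) • normalVec φ w := by
  rw [convNormal, ← integral_smul,
    ← integral_sub_left_eq_self (fun w => kerK d C (p.1 - w, p.2) • normalVec φ w) volume p.1]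
  simp only [sub_sub_cancel, kerK, bumpS, smul_smul]

lemma conv_hasFDerivAt {d : ℕ} (C : ℝ) (hC : 0 < C) (ν : Euc d → Euc d × ℝ) (hν : Continuous ν)
    (x : Euc d) (s : ℝ) (hs : 0 < s) :
    HasFDerivAt (fun p : Euc d × ℝ => ∫ w : Euc d, kerK d C (p.1 - w, p.2) • ν w)
      (∫ w : Euc d, (fderiv ℝ (kerK d C) (x - w, s)).smulRight (ν w)) (x, s) := by
  obtain ⟨B, hB⟩ : ∃ B, ∀ y : Euc d, ‖fderiv ℝ (kerK d C) (y, 1)‖ ≤ B :=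
    (supp_of _ 1 (fun y hy => dker_zero d C hC y 1 one_pos hy)).exists_bound_of_continuous
      (dker_cont d C 1 one_pos)
  have hB0 : 0 ≤ B := (norm_nonneg _).trans (hB 0)
  let U : Set (Euc d × ℝ) := ball x 1 ×ˢ Ioo (s / 2) (2 * s)
  have hU : U ∈ 𝓝 (x, s) :=
    prod_mem_nhds (ball_mem_nhds _ one_pos) (Ioo_mem_nhds (by linarith) (by linarith))
  have hcont : ∀ p : Euc d × ℝ, 0 < p.2 →
      Continuous (fun w => kerK d C (p.1 - w, p.2) • ν w) := fun p hp =>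
    ((ker_cont d C p.2 hp).comp (continuous_const.sub continuous_id)).smul hν
  refine hasFDerivAt_integral_of_dominated_of_fderiv_le (s := U)
    (F' := fun p w => (fderiv ℝ (kerK d C) (p.1 - w, p.2)).smulRight (ν w))
    (bound := (closedBall x (1 + 2 * s)).indicator
      (fun w => ((s / 2) ^ d)⁻¹ * B * ‖ν w‖)) hU ?_ ?_ ?_ ?_ ?_ ?_
  · filter_upwards [hU] with p hp
    have hp2 : 0 < p.2 := by have := hp.2.1; linarith
    exact (hcont p hp2).aestronglyMeasurable
  · refine (hcont (x, s) hs).integrable_of_hasCompactSupport ?_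
    apply HasCompactSupport.intro (isCompact_closedBall x s)
    intro w hw
    rw [mem_closedBall, not_le, dist_comm, dist_eq_norm] at hw
    show kerK d C (x - w, s) • ν w = 0
    rw [ker_zero d C _ s hs hw.le, zero_smul]
  · refine Continuous.aestronglyMeasurable ?_
    have h1 : Continuous (fun w => fderiv ℝ (kerK d C) (x - w, s)) :=
      (dker_cont d C s hs).comp (continuous_const.sub continuous_id)
    exact ((ContinuousLinearMap.smulRightL ℝ (Euc d × ℝ) (Euc d × ℝ)).continuous.comp h1).clm_apply hν
  · refine Eventually.of_forall fun w p hp => ?_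
    have hp2 : s / 2 < p.2 := hp.2.1
    have hp3 : p.2 < 2 * s := hp.2.2
    have hp0 : 0 < p.2 := by linarith
    have hp1 : dist p.1 x < 1 := hp.1
    by_cases hw : w ∈ closedBall x (1 + 2 * s)
    · rw [indicator_of_mem hw, ContinuousLinearMap.norm_smulRight_apply]
      have e : (p.1 - w, p.2) = p.2 • ((p.2⁻¹ • (p.1 - w), 1) : Euc d × ℝ) := by
        ext1
        · simp [smul_smul, hp0.ne']
        · simp
      rw [e, dker_smul d C p.2 hp0 _ one_pos, norm_smul, norm_inv, norm_pow,
        Real.norm_of_nonneg hp0.le]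
      gcongr
      exact hB _
    · rw [indicator_of_notMem hw]
      rw [mem_closedBall, not_le] at hw
      have : p.2 ≤ ‖p.1 - w‖ := by
        rw [← dist_eq_norm]
        have := dist_triangle w p.1 x
        rw [dist_comm w p.1] at this
        linarith
      simp [dker_zero d C hC _ _ hp0 this]
  · rw [integrable_indicator_iff measurableSet_closedBall]
    exact (ContinuousOn.integrableOn_compact (isCompact_closedBall _ _) (by fun_prop))
  · refine Eventually.of_forall fun w p hp => ?_
    have hp0 : 0 < p.2 := by have := hp.2.1; linarith
    have h1 := ((ker_contDiffAt d C (p.1 - w, p.2) hp0).differentiableAt (by simp)).hasFDerivAt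
    have h2 : HasFDerivAt (fun p : Euc d × ℝ => (p.1 - w, p.2))
        (ContinuousLinearMap.id ℝ (Euc d × ℝ)) p := by
      have := (hasFDerivAt_id (𝕜 := ℝ) p).sub_const ((w, 0) : Euc d × ℝ)
      have e : (fun p : Euc d × ℝ => (p.1 - w, p.2)) = fun x => id x - ((w, 0) : Euc d × ℝ) := by
        funext q
        ext1 <;> simp
      rw [e]
      exact this
    have h3 := (HasFDerivAt.comp p h1 h2).smul_const (ν w)
    simpa using h3

lemma conv_deriv_eq {d : ℕ} (C : ℝ) (ν : Euc d → Euc d × ℝ)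
    (x : Euc d) (s : ℝ) (hs : 0 < s) :
    (∫ w : Euc d, (fderiv ℝ (kerK d C) (x - w, s)).smulRight (ν w)) =
      ∫ z : Euc d, (fderiv ℝ (kerK d C) (z, 1)).smulRight (ν (x - s • z)) := by
  rw [← integral_sub_left_eq_self
    (fun w => (fderiv ℝ (kerK d C) (x - w, s)).smulRight (ν w)) volume x]
  simp only [sub_sub_cancel]
  have h := Measure.integral_comp_smul (volume : Measure (Euc d))
    (fun w => (fderiv ℝ (kerK d C) (w, s)).smulRight (ν (x - w))) s
  have e : ∀ z : Euc d, (fderiv ℝ (kerK d C) (s • z, s)).smulRight (ν (x - s • z)) =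
      (s ^ d)⁻¹ • (fderiv ℝ (kerK d C) (z, 1)).smulRight (ν (x - s • z)) := by
    intro z
    have := dker_smul d C s hs (z, 1) one_pos
    rw [Prod.smul_mk, smul_eq_mul, mul_one] at this
    rw [this]
    ext q <;> simp [mul_assoc]
  simp only [e] at h
  rw [integral_smul, finrank_euclideanSpace_fin,
    abs_of_pos (by positivity : 0 < (s ^ d)⁻¹)] at h
  exact (smul_right_injective _ (by positivity : (s ^ d)⁻¹ ≠ 0) h).symm

/-- Let `φ : ℝ^{d} → ℝ` (`d = n−1`) be differentiable with bounded,
Lipschitz gradient, `ν` the downward-graph unit normal, `η` the standard normalized bump,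
and `F(x,s) = (x, φ(x)) − s (η_s * ν)(x)` for `s > 0`. Then `F` is differentiable on
`ℝ^{d} × (0,∞)` and its total derivative `DF` is Lipschitz there: there is `L > 0` with
`‖DF(x₁,s₁) − DF(x₂,s₂)‖ ≤ L |(x₁−x₂, s₁−s₂)|` for all `x₁, x₂` and `s₁, s₂ > 0`. -/
theorem statement_11 (d : ℕ) (φ : Euc d → ℝ) (hφ : Differentiable ℝ φ)
    (Kgrad : ℝ≥0) (hLip : LipschitzWith Kgrad (gradient φ))
    (Kb : ℝ) (hKb : ∀ x, ‖gradient φ x‖ ≤ Kb)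
    (C : ℝ) (hC : 0 < C) (hnorm : ∫ x : Euc d, bump d C x = 1) :
    ∃ L > (0 : ℝ),
      (∀ (x : Euc d) (s : ℝ), 0 < s → DifferentiableAt ℝ (Fmap C φ) (x, s)) ∧
      ∀ (x₁ x₂ : Euc d) (s₁ s₂ : ℝ), 0 < s₁ → 0 < s₂ →
        ‖fderiv ℝ (Fmap C φ) (x₁, s₁) - fderiv ℝ (Fmap C φ) (x₂, s₂)‖ ≤
          L * ‖((x₁, s₁) : Euc d × ℝ) - (x₂, s₂)‖ := by
  have hνc : Continuous (normalVec φ) := by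
    have : LipschitzWith (2 * Kgrad) (normalVec φ) := by
      apply LipschitzWith.of_dist_le_mul
      intro x y
      rw [dist_eq_norm, dist_eq_norm]
      exact nu_lip φ Kgrad hLip x y
    exact this.continuous
  let A : Euc d → ℝ → (Euc d × ℝ →L[ℝ] Euc d × ℝ) := fun x s =>
    ∫ z : Euc d, (fderiv ℝ (kerK d C) (z, 1)).smulRight (normalVec φ (x - s • z))
  have hF : ∀ (x : Euc d) (s : ℝ), 0 < s → HasFDerivAt (Fmap C φ)
      ((ContinuousLinearMap.fst ℝ (Euc d) ℝ).prod
        ((fderiv ℝ φ x).comp (ContinuousLinearMap.fst ℝ (Euc d) ℝ)) - A x s) (x, s) := by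
    intro x s hs
    have h1 := conv_hasFDerivAt C hC (normalVec φ) hνc x s hs
    rw [conv_deriv_eq C (normalVec φ) x s hs] at h1
    have h2 : HasFDerivAt (fun p : Euc d × ℝ => φ p.1)
        ((fderiv ℝ φ x).comp (ContinuousLinearMap.fst ℝ (Euc d) ℝ)) (x, s) :=
      HasFDerivAt.comp (x, s) (hφ x).hasFDerivAt hasFDerivAt_fst
    have h3 := (hasFDerivAt_fst (𝕜 := ℝ) (p := (x, s))).prodMk h2
    have h4 := h3.sub h1
    have e : Fmap C φ = fun p => ((p.1, φ p.1) : Euc d × ℝ) -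
        ∫ w : Euc d, kerK d C (p.1 - w, p.2) • normalVec φ w := by
      funext p
      rw [← conv_eq, Fmap]
    rw [e]
    exact h4
  have hMc := dker_cont d C 1 one_pos
  have hMs := supp_of _ 1 (fun y hy => dker_zero d C hC y 1 one_pos hy)
  let I : ℝ := ∫ z : Euc d, ‖fderiv ℝ (kerK d C) (z, 1)‖
  have hI0 : 0 ≤ I := integral_nonneg fun _ => norm_nonneg _
  have hIi : Integrable (fun z : Euc d => ‖fderiv ℝ (kerK d C) (z, 1)‖) :=
    (hMc.integrable_of_hasCompactSupport hMs).norm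
  have hAi : ∀ (x : Euc d) (s : ℝ), Integrable (fun z : Euc d =>
      (fderiv ℝ (kerK d C) (z, 1)).smulRight (normalVec φ (x - s • z))) := by
    intro x s
    apply Continuous.integrable_of_hasCompactSupport
    · exact ((ContinuousLinearMap.smulRightL ℝ (Euc d × ℝ) (Euc d × ℝ)).continuous.comp
        hMc).clm_apply (hνc.comp (by fun_prop))
    · apply supp_of _ 1
      intro y hy
      simp [dker_zero d C hC y 1 one_pos hy]
  have hA : ∀ (x₁ x₂ : Euc d) (s₁ s₂ : ℝ), ‖A x₁ s₁ - A x₂ s₂‖ ≤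
      4 * Kgrad * I * ‖((x₁, s₁) : Euc d × ℝ) - (x₂, s₂)‖ := by
    intro x₁ x₂ s₁ s₂
    set D := ‖((x₁, s₁) : Euc d × ℝ) - (x₂, s₂)‖ with hD
    have hx : ‖x₁ - x₂‖ ≤ D := norm_fst_le (((x₁, s₁) : Euc d × ℝ) - (x₂, s₂))
    have hs : ‖s₁ - s₂‖ ≤ D := norm_snd_le (((x₁, s₁) : Euc d × ℝ) - (x₂, s₂))
    have hD0 : 0 ≤ D := norm_nonneg _
    rw [← integral_sub (hAi x₁ s₁) (hAi x₂ s₂)]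
    have : 4 * Kgrad * I * D =
        ∫ z : Euc d, ‖fderiv ℝ (kerK d C) (z, 1)‖ * (4 * Kgrad * D) := by
      rw [integral_mul_const]; ring
    rw [this]
    apply norm_integral_le_of_norm_le (hIi.mul_const _)
    refine Eventually.of_forall fun z => ?_
    have e : (fderiv ℝ (kerK d C) (z, 1)).smulRight (normalVec φ (x₁ - s₁ • z)) -
        (fderiv ℝ (kerK d C) (z, 1)).smulRight (normalVec φ (x₂ - s₂ • z)) =
        (fderiv ℝ (kerK d C) (z, 1)).smulRight
          (normalVec φ (x₁ - s₁ • z) - normalVec φ (x₂ - s₂ • z)) := by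
      refine ContinuousLinearMap.ext fun q => ?_
      simp only [ContinuousLinearMap.sub_apply, ContinuousLinearMap.smulRight_apply, smul_sub]
    rw [e, ContinuousLinearMap.norm_smulRight_apply]
    by_cases hz : 1 ≤ ‖z‖
    · simp [dker_zero d C hC z 1 one_pos hz]
    · rw [not_le] at hz
      gcongr
      refine (nu_lip φ Kgrad hLip _ _).trans ?_
      have : ‖x₁ - s₁ • z - (x₂ - s₂ • z)‖ ≤ 2 * D := by
        have e2 : x₁ - s₁ • z - (x₂ - s₂ • z) = (x₁ - x₂) - (s₁ - s₂) • z := by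
          rw [sub_smul]; abel
        rw [e2]
        refine (norm_sub_le _ _).trans ?_
        rw [norm_smul]
        nlinarith [norm_nonneg z, norm_nonneg (s₁ - s₂)]
      calc 2 * (Kgrad : ℝ) * ‖x₁ - s₁ • z - (x₂ - s₂ • z)‖ ≤ 2 * Kgrad * (2 * D) := by gcongr
        _ = _ := by ring
  refine ⟨Kgrad + 4 * Kgrad * I + 1, by positivity,
    fun x s hs => (hF x s hs).differentiableAt, ?_⟩
  intro x₁ x₂ s₁ s₂ h1 h2
  rw [(hF x₁ s₁ h1).fderiv, (hF x₂ s₂ h2).fderiv]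
  have hA' := hA x₁ x₂ s₁ s₂
  have hx : ‖x₁ - x₂‖ ≤ ‖((x₁, s₁) : Euc d × ℝ) - (x₂, s₂)‖ :=
    norm_fst_le (((x₁, s₁) : Euc d × ℝ) - (x₂, s₂))
  set D := ‖((x₁, s₁) : Euc d × ℝ) - (x₂, s₂)‖ with hD
  have hD0 : 0 ≤ D := norm_nonneg _
  have hg : ‖fderiv ℝ φ x₁ - fderiv ℝ φ x₂‖ ≤ Kgrad * D := by
    have := hLip.dist_le_mul x₁ x₂
    rw [dist_eq_norm, dist_eq_norm, gradient, gradient, ← map_sub, LinearIsometryEquiv.norm_map] at this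
    exact this.trans (by gcongr)
  have hP : ‖(ContinuousLinearMap.fst ℝ (Euc d) ℝ).prod
        ((fderiv ℝ φ x₁).comp (ContinuousLinearMap.fst ℝ (Euc d) ℝ)) -
      (ContinuousLinearMap.fst ℝ (Euc d) ℝ).prod
        ((fderiv ℝ φ x₂).comp (ContinuousLinearMap.fst ℝ (Euc d) ℝ))‖ ≤ Kgrad * D := by
    apply ContinuousLinearMap.opNorm_le_bound _ (by positivity)
    intro q
    have e : ((ContinuousLinearMap.fst ℝ (Euc d) ℝ).prod
        ((fderiv ℝ φ x₁).comp (ContinuousLinearMap.fst ℝ (Euc d) ℝ)) -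
      (ContinuousLinearMap.fst ℝ (Euc d) ℝ).prod
        ((fderiv ℝ φ x₂).comp (ContinuousLinearMap.fst ℝ (Euc d) ℝ))) q =
        ((0 : Euc d), (fderiv ℝ φ x₁ - fderiv ℝ φ x₂) q.1) := by
      ext1 <;> simp
    rw [e, Prod.norm_mk, norm_zero, max_eq_right (norm_nonneg _)]
    refine (ContinuousLinearMap.le_opNorm _ _).trans ?_
    gcongr
    exact norm_fst_le q
  rw [sub_sub_sub_comm]
  refine (norm_sub_le _ _).trans ?_
  nlinarith
end
end
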